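/- Let k be an infinite cardinal and let Y be a G_δσ-subset of the space B*(k) such that Y does not belong to the class 𝓕_σδ ∖ σLW(<k). Then Y contains a nowhere dense closed subset homeomorphic to A^{II}_k. -/

import Mathlib

open Topology Set Filter

universe u v

noncomputable section

/-- Strong zero-dimensionality (`Ind X = 0`): any two disjoint closed sets
can be separated by a clopen set. -/
def StronglyZeroDim (X : Type*) [TopologicalSpace X] : Prop :=
  ∀ A B : Set X, IsClosed A → IsClosed B → Disjoint A B →
    ∃ U : Set X, IsClopen U ∧ A ⊆ U ∧ Disjoint B U

/-- The topological weight of a space: the least cardinality of a base. -/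
def topWeight (X : Type u) [TopologicalSpace X] : Cardinal.{u} :=
  ⨅ B : {B : Set (Set X) // TopologicalSpace.IsTopologicalBasis B}, Cardinal.mk B.1

/-- The space has a base of cardinality `< k`. -/
def WeightLT (X : Type u) [TopologicalSpace X] (k : Cardinal.{u}) : Prop :=
  ∃ B : Set (Set X), TopologicalSpace.IsTopologicalBasis B ∧ Cardinal.mk B < k

/-- Every point has a neighborhood of weight `< k`. -/
def LocallyWeightLT (X : Type u) [TopologicalSpace X] (k : Cardinal.{u}) : Prop :=
  ∀ x : X, ∃ s : Set X, s ∈ nhds x ∧ WeightLT ↥s k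

/-- `X ∈ σLW(<k)`: `X` is a countable union of subspaces, each locally of weight `< k`. -/
def SigmaLW (X : Type u) [TopologicalSpace X] (k : Cardinal.{u}) : Prop :=
  ∃ S : ℕ → Set X, (⋃ n, S n) = Set.univ ∧ ∀ n, LocallyWeightLT ↥(S n) k

/-- A `G_δσ`-subset: a countable union of `G_δ`-sets. -/
def IsGdeltaSigma {Y : Type*} [TopologicalSpace Y] (s : Set Y) : Prop :=
  ∃ G : ℕ → Set Y, (∀ n, IsGδ (G n)) ∧ s = ⋃ n, G n

/-- An `F_σ`-subset: a countable union of closed sets. -/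
def IsFsigmaSet {Y : Type*} [TopologicalSpace Y] (s : Set Y) : Prop :=
  ∃ F : ℕ → Set Y, (∀ n, IsClosed (F n)) ∧ s = ⋃ n, F n

/-- An `F_σδ`-subset: a countable intersection of `F_σ`-sets. -/
def IsFsigmaDelta {Y : Type*} [TopologicalSpace Y] (s : Set Y) : Prop :=
  ∃ F : ℕ → Set Y, (∀ n, IsFsigmaSet (F n)) ∧ s = ⋂ n, F n

/-- An absolute `G_δσ`-set: a metrizable space whose image under every embedding
into a metrizable space is a countable union of `G_δ`-sets. -/
def AbsGdeltaSigma (X : Type u) [TopologicalSpace X] : Prop :=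
  TopologicalSpace.MetrizableSpace X ∧
    ∀ (Y : Type u) [TopologicalSpace Y] [TopologicalSpace.MetrizableSpace Y]
      (f : X → Y), Topology.IsEmbedding f → IsGdeltaSigma (Set.range f)

/-- An absolute `F_σδ`-set: a metrizable space whose image under every embedding
into a metrizable space is an `F_σδ`-set. -/
def AbsFsigmaDelta (X : Type u) [TopologicalSpace X] : Prop :=
  TopologicalSpace.MetrizableSpace X ∧
    ∀ (Y : Type u) [TopologicalSpace Y] [TopologicalSpace.MetrizableSpace Y]
      (f : X → Y), Topology.IsEmbedding f → IsFsigmaDelta (Set.range f)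

/-- `X ∈ σLW(<k) + 𝒢_δσ` : `X = A ∪ B` with `A ∈ σLW(<k)` and `B` an absolute
`G_δσ`-set. -/
def SLWplusGDS (X : Type u) [TopologicalSpace X] (k : Cardinal.{u}) : Prop :=
  ∃ A B : Set X, A ∪ B = Set.univ ∧ SigmaLW ↥A k ∧ AbsGdeltaSigma ↥B

/-- No nonempty open subspace is `σLW(<k) + 𝒢_δσ`. -/
def NowhereSLWplusGDS (X : Type u) [TopologicalSpace X] (k : Cardinal.{u}) : Prop :=
  ∀ U : Set X, IsOpen U → U.Nonempty → ¬ SLWplusGDS ↥U k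

/-- A space is of first category if it is meager in itself. -/
def FirstCategory (X : Type*) [TopologicalSpace X] : Prop :=
  IsMeagre (Set.univ : Set X)

/-- A Souslin (analytic) subset of a space:
`s = ⋃_{t ∈ ω^ω} ⋂_n F(t↾n)` for a family of closed sets indexed by finite tuples. -/
def IsSuslinIn {Y : Type*} [TopologicalSpace Y] (s : Set Y) : Prop :=
  ∃ F : List ℕ → Set Y, (∀ l, IsClosed (F l)) ∧
    s = ⋃ t : ℕ → ℕ, ⋂ n : ℕ, F (List.ofFn fun i : Fin n => t i)

/-- An absolute Souslin space: metrizable, and Souslin in every completely metrizable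
space into which it embeds. -/
def AbsSuslin (X : Type u) [TopologicalSpace X] : Prop :=
  TopologicalSpace.MetrizableSpace X ∧
    ∀ (Y : Type u) [MetricSpace Y] [CompleteSpace Y] (f : X → Y),
      Topology.IsEmbedding f → IsSuslinIn (Set.range f)

/-- An h-homogeneous space: every nonempty clopen subset is homeomorphic to the
whole space. -/
def HHomogeneous (X : Type*) [TopologicalSpace X] : Prop :=
  ∀ U : Set X, IsClopen U → U.Nonempty → Nonempty (↥U ≃ₜ X)

/-- A discrete family of sets: every point has a neighborhood meeting at most one
member of the family. -/
def DiscreteFamily {X : Type*} [TopologicalSpace X] {ι : Type*} (f : ι → Set X) : Prop :=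
  ∀ x : X, ∃ U ∈ nhds x, {i | (f i ∩ U).Nonempty}.Subsingleton

/-- A discrete space of cardinality `k`. -/
def DiscT (k : Cardinal.{u}) : Type u := k.out

instance (k : Cardinal.{u}) : TopologicalSpace (DiscT k) := ⊥
instance (k : Cardinal.{u}) : DiscreteTopology (DiscT k) := ⟨rfl⟩

/-- The Baire space `B(k) = k^ω`. -/
def BaireB (k : Cardinal.{u}) : Type u := ℕ → DiscT k

instance (k : Cardinal.{u}) : TopologicalSpace (BaireB k) :=
  inferInstanceAs (TopologicalSpace (ℕ → DiscT k))

open Classical in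
/-- The discrete factor of `B*(k)`: two points if `k = ℵ₀`, and `k` points otherwise. -/
def StarT (k : Cardinal.{u}) : Type u :=
  if k = Cardinal.aleph0 then ULift Bool else DiscT k

instance (k : Cardinal.{u}) : TopologicalSpace (StarT k) := ⊥
instance (k : Cardinal.{u}) : DiscreteTopology (StarT k) := ⟨rfl⟩

/-- `B*(k)`: the Cantor set `2^ω` if `k = ℵ₀`, and the Baire space `B(k)` if `k > ℵ₀`. -/
def BaireStar (k : Cardinal.{u}) : Type u := ℕ → StarT k

instance (k : Cardinal.{u}) : TopologicalSpace (BaireStar k) :=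
  inferInstanceAs (TopologicalSpace (ℕ → StarT k))

/-- A discrete space of cardinality `k` (for infinite `k`), with a distinguished basepoint. -/
def QBase (k : Cardinal.{u}) : Type u := DiscT k ⊕ PUnit.{u + 1}

instance (k : Cardinal.{u}) : TopologicalSpace (QBase k) := ⊥
instance (k : Cardinal.{u}) : DiscreteTopology (QBase k) := ⟨rfl⟩

/-- `Q(k)`: the σ-product of `ω` copies of a discrete space of cardinality `k`, i.e.
the subspace of the product consisting of the sequences eventually equal to the basepoint. -/
def Qk (k : Cardinal.{u}) : Type u :=
  {x : ℕ → QBase k // ∀ᶠ n in Filter.atTop, x n = Sum.inr PUnit.unit}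

instance (k : Cardinal.{u}) : TopologicalSpace (Qk k) :=
  inferInstanceAs (TopologicalSpace
    {x : ℕ → QBase k // ∀ᶠ n in Filter.atTop, x n = Sum.inr PUnit.unit})

/-- The countable power `Q(k)^ω`. -/
def QkOmega (k : Cardinal.{u}) : Type u := ℕ → Qk k

instance (k : Cardinal.{u}) : TopologicalSpace (QkOmega k) :=
  inferInstanceAs (TopologicalSpace (ℕ → Qk k))

/-- `Z` is homeomorphic to `Q(k)^ω`. -/
def IsQkOmega (k : Cardinal.{u}) (Z : Type*) [TopologicalSpace Z] : Prop :=
  Nonempty (Z ≃ₜ QkOmega k)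

/-- `Z` is homeomorphic to `A^{II}_k`, the complement in `B*(k)` of a dense copy of
`Q(k)^ω`. -/
def IsAII (k : Cardinal.{u}) (Z : Type*) [TopologicalSpace Z] : Prop :=
  ∃ A : Set (BaireStar k), Dense A ∧ IsQkOmega k ↥A ∧ Nonempty (Z ≃ₜ ↥(Aᶜ))

/-- `Z` is homeomorphic to `A^I_k = Q × A^{II}_k`. -/
def IsAI (k : Cardinal.{u}) (Z : Type*) [TopologicalSpace Z] : Prop :=
  ∃ A : Set (BaireStar k), Dense A ∧ IsQkOmega k ↥A ∧ Nonempty (Z ≃ₜ (ℚ × ↥(Aᶜ)))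

/-- `Z` is homeomorphic to `M^{II}_k`, the complement in `B*(k)` of a dense copy of
`A^I_k`. -/
def IsMII (k : Cardinal.{u}) (Z : Type*) [TopologicalSpace Z] : Prop :=
  ∃ Y : Set (BaireStar k), Dense Y ∧ IsAI k ↥Y ∧ Nonempty (Z ≃ₜ ↥(Yᶜ))

/-- `X ∈ 𝓕_σδ ∖ σLW(<k)`: `X` is homeomorphic to `F ∖ L` for some absolute
`F_σδ`-space `F` and some `L ⊆ F` with `L ∈ σLW(<k)`. -/
def FsdMinusSLW (X : Type u) [TopologicalSpace X] (k : Cardinal.{u}) : Prop :=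
  ∃ (F : TopCat.{u}) (L : Set F), AbsFsigmaDelta ↥F ∧ SigmaLW ↥L k ∧
    Nonempty (X ≃ₜ ↥(Lᶜ))

/-- No nonempty open subspace is in the class `𝓕_σδ ∖ σLW(<k)`. -/
def NowhereFsdMinusSLW (X : Type u) [TopologicalSpace X] (k : Cardinal.{u}) : Prop :=
  ∀ U : Set X, IsOpen U → U.Nonempty → ¬ FsdMinusSLW ↥U k

/-- A topologically complete (i.e. completely metrizable) space. -/
def CompletelyMetrizable (X : Type*) [t : TopologicalSpace X] : Prop :=
  ∃ m : MetricSpace X, m.toUniformSpace.toTopologicalSpace = t ∧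
    @CompleteSpace X m.toUniformSpace

end
set_option linter.unusedSectionVars false

namespace AIIProof

section Basic

variable {T : Type u} [TopologicalSpace T] [DiscreteTopology T]

/-- The cylinder of length `n` around `x`. -/
def cyl {T : Type u} (x : ℕ → T) (n : ℕ) : Set (ℕ → T) := {y | ∀ i < n, y i = x i}

theorem mem_cyl {T : Type u} {x y : ℕ → T} {n : ℕ} : y ∈ cyl x n ↔ ∀ i < n, y i = x i := Iff.rfl

theorem self_mem_cyl {T : Type u} (x : ℕ → T) (n : ℕ) : x ∈ cyl x n := fun _ _ => rfl

theorem cyl_eq {T : Type u} {x y : ℕ → T} {n : ℕ} (h : y ∈ cyl x n) : cyl y n = cyl x n := by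
  ext z
  simp only [mem_cyl] at *
  constructor
  · intro hz i hi; rw [hz i hi, h i hi]
  · intro hz i hi; rw [hz i hi, h i hi]

theorem cyl_anti {T : Type u} (x : ℕ → T) {m n : ℕ} (h : m ≤ n) : cyl x n ⊆ cyl x m :=
  fun _ hy i hi => hy i (hi.trans_le h)

theorem cyl_sub {T : Type u} {x y : ℕ → T} {m n : ℕ} (h : m ≤ n) (hy : y ∈ cyl x m) :
    cyl y n ⊆ cyl x m := by
  rw [← cyl_eq hy]; exact cyl_anti y h

theorem isOpen_cyl (x : ℕ → T) (n : ℕ) : IsOpen (cyl x n) := by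
  have : cyl x n = ⋂ i ∈ Finset.range n, (fun y : ℕ → T => y i) ⁻¹' {x i} := by
    ext y; simp [mem_cyl]
  rw [this]
  refine isOpen_biInter_finset fun i _ => ?_
  exact (isOpen_discrete _).preimage (continuous_apply i)

theorem exists_cyl_sub {U : Set (ℕ → T)} (hU : IsOpen U) {x : ℕ → T} (hx : x ∈ U) (m : ℕ) :
    ∃ n, m ≤ n ∧ cyl x n ⊆ U := by
  obtain ⟨I, u, h1, h2⟩ := isOpen_pi_iff.1 hU x hx
  obtain ⟨N, hN⟩ := I.exists_nat_subset_range
  refine ⟨max m N, le_max_left _ _, fun y hy => h2 ?_⟩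
  intro a ha
  have : a < N := Finset.mem_range.1 (hN ha)
  rw [hy a (this.trans_le (le_max_right _ _))]
  exact (h1 a ha).2

theorem isOpen_iff_cyl {U : Set (ℕ → T)} : IsOpen U ↔ ∀ x ∈ U, ∃ n, cyl x n ⊆ U := by
  constructor
  · intro h x hx
    obtain ⟨n, -, hn⟩ := exists_cyl_sub h hx 0
    exact ⟨n, hn⟩
  · intro h
    refine isOpen_iff_mem_nhds.2 fun x hx => ?_
    obtain ⟨n, hn⟩ := h x hx
    exact Filter.mem_of_superset ((isOpen_cyl x n).mem_nhds (self_mem_cyl x n)) hn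

theorem isClosed_cyl (x : ℕ → T) (n : ℕ) : IsClosed (cyl x n) := by
  rw [← isOpen_compl_iff, isOpen_iff_cyl]
  intro y hy
  refine ⟨n, fun z hz hz' => hy ?_⟩
  rw [← cyl_eq hz', cyl_eq hz]; exact self_mem_cyl _ _

theorem mem_of_closed {C : Set (ℕ → T)} (hC : IsClosed C) {x : ℕ → T}
    (h : ∀ n, ∃ y ∈ C, y ∈ cyl x n) : x ∈ C := by
  by_contra hx
  obtain ⟨n, hn⟩ := isOpen_iff_cyl.1 hC.isOpen_compl x hx
  obtain ⟨y, hy, hyc⟩ := h n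
  exact hn hyc hy

theorem closed_isGδ {C : Set (ℕ → T)} (hC : IsClosed C) : IsGδ C := by
  have : C = ⋂ n, ⋃ x ∈ C, cyl x n := by
    ext y
    simp only [mem_iInter, mem_iUnion]
    constructor
    · intro hy n; exact ⟨y, hy, self_mem_cyl _ _⟩
    · intro h
      refine mem_of_closed hC fun n => ?_
      obtain ⟨x, hx, hxy⟩ := h n
      exact ⟨x, hx, by rw [cyl_eq hxy]; exact self_mem_cyl _ _⟩
  rw [this]
  exact IsGδ.iInter_of_isOpen fun n => isOpen_biUnion fun x _ => isOpen_cyl x n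

/-- Gluing sets along the cylinders of a given length. -/
def glue {T : Type u} (D : Set (ℕ → T) → Set (ℕ → T)) (l : ℕ) : Set (ℕ → T) :=
  {z | z ∈ D (cyl z l)}

theorem mem_glue {T : Type u} {D : Set (ℕ → T) → Set (ℕ → T)} {l : ℕ} {z : ℕ → T} :
    z ∈ glue D l ↔ z ∈ D (cyl z l) := Iff.rfl

theorem isOpen_glue {D : Set (ℕ → T) → Set (ℕ → T)} (h : ∀ c, IsOpen (D c)) (l : ℕ) :
    IsOpen (glue D l) := by
  rw [isOpen_iff_cyl]
  intro x hx
  obtain ⟨n, hn, hn'⟩ := exists_cyl_sub (h (cyl x l)) hx l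
  refine ⟨n, fun y hy => ?_⟩
  rw [mem_glue, cyl_eq (cyl_anti x hn hy)]
  exact hn' hy

theorem isClosed_glue {D : Set (ℕ → T) → Set (ℕ → T)} (h : ∀ c, IsClosed (D c)) (l : ℕ) :
    IsClosed (glue D l) := by
  have := isOpen_glue (D := fun c => (D c)ᶜ) (fun c => (h c).isOpen_compl) l
  exact ⟨this⟩

theorem isGδ_glue {D : Set (ℕ → T) → Set (ℕ → T)} (h : ∀ c, IsGδ (D c)) (l : ℕ) :
    IsGδ (glue D l) := by
  choose f hf hD using fun c => isGδ_iff_eq_iInter_nat.1 (h c)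
  have : glue D l = ⋂ n, glue (fun c => f c n) l := by
    ext z
    simp only [mem_iInter, mem_glue]
    rw [hD]; simp
  rw [this]
  exact IsGδ.iInter_of_isOpen fun n => isOpen_glue (fun c => hf c n) l

/-- The set of prefixes of length `n` of elements of `Z`. -/
def pref {T : Type u} (Z : Set (ℕ → T)) (n : ℕ) : Set (Fin n → T) :=
  (fun (x : ℕ → T) (i : Fin n) => x i) '' Z

theorem pref_mono {T : Type u} {Z Z' : Set (ℕ → T)} (h : Z ⊆ Z') (n : ℕ) : pref Z n ⊆ pref Z' n :=
  image_mono h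

/-- A uniform bound, less than `k`, on the number of prefixes. -/
def Few (k : Cardinal.{u}) (Z : Set (ℕ → T)) : Prop :=
  Cardinal.aleph0 < k ∧ ∃ κ < k, ∀ n, Cardinal.mk (pref Z n) ≤ κ

theorem Few.mono {k : Cardinal.{u}} {Z Z' : Set (ℕ → T)} (h : Few k Z') (hZ : Z ⊆ Z') :
    Few k Z := by
  obtain ⟨h0, κ, hκ, h⟩ := h
  exact ⟨h0, κ, hκ, fun n => (Cardinal.mk_le_mk_of_subset (pref_mono hZ n)).trans (h n)⟩

/-- Locally few prefixes. -/
def LocFew (k : Cardinal.{u}) (Z : Set (ℕ → T)) : Prop :=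
  ∀ x ∈ Z, ∃ n, Few k (Z ∩ cyl x n)

theorem LocFew.glue {k : Cardinal.{u}} {D : Set (ℕ → T) → Set (ℕ → T)}
    (h : ∀ c, LocFew k (D c)) (l : ℕ) : LocFew k (glue D l) := by
  intro x hx
  obtain ⟨n, hn⟩ := h _ x hx
  refine ⟨max n l, hn.mono ?_⟩
  rintro z ⟨hz, hzc⟩
  rw [mem_glue, cyl_eq (cyl_anti x (le_max_right _ _) hzc)] at hz
  exact ⟨hz, cyl_anti x (le_max_left _ _) hzc⟩

/-- The small sets: unions of a `G_δσ` and a countable union of sets with locally few prefixes. -/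
def Small (k : Cardinal.{u}) (S : Set (ℕ → T)) : Prop :=
  ∃ P Q : ℕ → Set (ℕ → T), (∀ n, IsGδ (P n)) ∧ (∀ n, LocFew k (Q n)) ∧ S = ⋃ n, (P n ∪ Q n)

theorem small_of_isGδ {k : Cardinal.{u}} {S : Set (ℕ → T)} (h : IsGδ S) : Small k S := by
  refine ⟨fun _ => S, fun _ => ∅, fun _ => h, fun _ x hx => hx.elim, ?_⟩
  simp [iUnion_const]

theorem small_of_few {k : Cardinal.{u}} {S : Set (ℕ → T)} (h : Few k S) : Small k S := by
  refine ⟨fun _ => ∅, fun _ => S, fun _ => IsGδ.empty,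
    fun _ x hx => ⟨0, h.mono inter_subset_left⟩, ?_⟩
  simp [iUnion_const]

theorem small_iUnion {k : Cardinal.{u}} {S : ℕ → Set (ℕ → T)} (h : ∀ n, Small k (S n)) :
    Small k (⋃ n, S n) := by
  choose P Q hP hQ hS using h
  refine ⟨fun n => P n.unpair.1 n.unpair.2, fun n => Q n.unpair.1 n.unpair.2,
    fun n => hP _ _, fun n => hQ _ _, ?_⟩
  ext x
  simp only [mem_iUnion]
  constructor
  · rintro ⟨n, hn⟩
    rw [hS n, mem_iUnion] at hn
    obtain ⟨m, hm⟩ := hn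
    exact ⟨Nat.pair n m, by simpa using hm⟩
  · rintro ⟨n, hn⟩
    refine ⟨n.unpair.1, ?_⟩
    rw [hS, mem_iUnion]
    exact ⟨_, hn⟩

theorem small_union {k : Cardinal.{u}} {S S' : Set (ℕ → T)} (h : Small k S) (h' : Small k S') :
    Small k (S ∪ S') := by
  have : S ∪ S' = ⋃ n : ℕ, if n = 0 then S else S' := by
    ext x
    simp only [mem_union, mem_iUnion]
    constructor
    · rintro (h | h)
      · exact ⟨0, by simpa using h⟩
      · exact ⟨1, by simpa using h⟩
    · rintro ⟨n, hn⟩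
      split_ifs at hn
      · exact Or.inl hn
      · exact Or.inr hn
  rw [this]
  refine small_iUnion fun n => ?_
  split_ifs <;> assumption

theorem small_glue {k : Cardinal.{u}} {S : Set (ℕ → T) → Set (ℕ → T)} (h : ∀ c, Small k (S c))
    (l : ℕ) : Small k (glue S l) := by
  choose P Q hP hQ hS using h
  refine ⟨fun n => glue (fun c => P c n) l, fun n => glue (fun c => Q c n) l,
    fun n => isGδ_glue (fun c => hP c n) l, fun n => LocFew.glue (fun c => hQ c n) l, ?_⟩
  ext z
  simp only [mem_iUnion, mem_glue, mem_union]
  rw [hS]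
  simp

/-- `S` is coverable (relative to `X`) if it is covered by an `F_σ` meeting `X` in a small set. -/
def Cov (k : Cardinal.{u}) (X S : Set (ℕ → T)) : Prop :=
  ∃ W : ℕ → Set (ℕ → T), (∀ n, IsClosed (W n)) ∧ S ⊆ (⋃ n, W n) ∧ Small k ((⋃ n, W n) ∩ X)

theorem Cov.mono {k : Cardinal.{u}} {X S S' : Set (ℕ → T)} (h : Cov k X S') (hS : S ⊆ S') :
    Cov k X S := by
  obtain ⟨W, h1, h2, h3⟩ := h
  exact ⟨W, h1, hS.trans h2, h3⟩

theorem cov_iUnion {k : Cardinal.{u}} {X : Set (ℕ → T)} {S : ℕ → Set (ℕ → T)}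
    (h : ∀ n, Cov k X (S n)) : Cov k X (⋃ n, S n) := by
  choose W h1 h2 h3 using h
  have key : (⋃ n : ℕ, W n.unpair.1 n.unpair.2) = ⋃ n, ⋃ m, W n m := by
    ext x
    simp only [mem_iUnion]
    constructor
    · rintro ⟨n, hn⟩; exact ⟨_, _, hn⟩
    · rintro ⟨n, m, hn⟩; exact ⟨Nat.pair n m, by simpa using hn⟩
  refine ⟨fun n => W n.unpair.1 n.unpair.2, fun n => h1 _ _, ?_, ?_⟩
  · rw [key]; exact iUnion_mono h2
  · rw [key, iUnion_inter]; exact small_iUnion h3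

theorem cov_union {k : Cardinal.{u}} {X S S' : Set (ℕ → T)} (h : Cov k X S) (h' : Cov k X S') :
    Cov k X (S ∪ S') := by
  refine (cov_iUnion (S := fun n : ℕ => if n = 0 then S else S') fun n => ?_).mono ?_
  · split_ifs <;> assumption
  · rintro x (h | h)
    · exact mem_iUnion.2 ⟨0, by simpa using h⟩
    · exact mem_iUnion.2 ⟨1, by simpa using h⟩

theorem cov_empty {k : Cardinal.{u}} {X : Set (ℕ → T)} : Cov k X ∅ :=
  ⟨fun _ => ∅, fun _ => isClosed_empty, empty_subset _, by
    simpa using small_of_isGδ (k := k) (IsGδ.empty (X := ℕ → T))⟩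

theorem cov_local {k : Cardinal.{u}} {X S : Set (ℕ → T)} (l : ℕ) :
    Cov k X (S ∩ {x | Cov k X (S ∩ cyl x l)}) := by
  classical
  have h : ∀ c : Set (ℕ → T), Cov k X (if Cov k X (S ∩ c) then S ∩ c else ∅) := by
    intro c; split_ifs with h
    · exact h
    · exact cov_empty
  choose W h1 h2 h3 using h
  have key : (⋃ n, glue (fun c => W c n) l) = glue (fun c => ⋃ n, W c n) l := by
    ext z; simp [mem_glue]
  refine ⟨fun n => glue (fun c => W c n) l, fun n => isClosed_glue (fun c => h1 c n) l, ?_, ?_⟩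
  · rw [key]
    rintro x ⟨hx, hx'⟩
    have hx' : Cov k X (S ∩ cyl x l) := hx'
    rw [mem_glue]
    apply h2
    rw [if_pos hx']
    exact ⟨hx, self_mem_cyl _ _⟩
  · rw [key]
    exact small_glue h3 l

/-- The good closed sets. -/
structure Good (k : Cardinal.{u}) (X : Set (ℕ → T)) (E : Set (ℕ → T) × (ℕ → Set (ℕ → T))) :
    Prop where
  closed : IsClosed E.1
  closedD : ∀ i, IsClosed (E.2 i)
  mono : Monotone E.2
  nwd : ∀ i, ∀ x ∈ E.1, ∀ n, ∃ y ∈ E.1, y ∈ cyl x n ∧ y ∉ E.2 i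
  cover : X ∩ E.1 ⊆ ⋃ i, E.2 i
  big : ∀ x ∈ E.1, ∀ n, ¬ Small k (X ∩ E.1 ∩ cyl x n)

theorem lemmaA {k : Cardinal.{u}} {X C : Set (ℕ → T)} {G : ℕ → Set (ℕ → T)}
    (hG : ∀ j, IsGδ (G j)) (hX : X = (⋃ j, G j)ᶜ) (hC : IsClosed C) (hbig : ¬ Small k (X ∩ C)) :
    ∃ E, Good k X E ∧ E.1.Nonempty ∧ E.1 ⊆ C := by
  have h1 : ∃ j, ¬ Cov k (X ∩ C) (G j ∩ C) := by
    by_contra hcon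
    push Not at hcon
    obtain ⟨W, hW1, hW2, hW3⟩ := cov_iUnion hcon
    apply hbig
    have : X ∩ C = ((⋃ n, W n) ∩ (X ∩ C)) ∪ (C ∩ ⋂ n, (W n)ᶜ) := by
      rw [← compl_iUnion]
      ext x
      constructor
      · rintro hx
        by_cases hxW : x ∈ ⋃ n, W n
        · exact Or.inl ⟨hxW, hx⟩
        · exact Or.inr ⟨hx.2, hxW⟩
      · rintro (hx | hx)
        · exact hx.2
        · refine ⟨?_, hx.1⟩
          rw [hX]
          intro hx'
          apply hx.2
          apply hW2
          obtain ⟨j, hj⟩ := mem_iUnion.1 hx'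
          exact mem_iUnion.2 ⟨j, hj, hx.1⟩
    rw [this]
    refine small_union hW3 (small_of_isGδ ?_)
    exact (closed_isGδ hC).inter (IsGδ.iInter_of_isOpen fun n => (hW1 n).isOpen_compl)
  obtain ⟨j, hj⟩ := h1
  set S := G j ∩ C with hS
  set V : Set (ℕ → T) := ⋃ l, {x | Cov k (X ∩ C) (S ∩ cyl x l)} with hV
  have hVcov : Cov k (X ∩ C) (S ∩ V) := by
    rw [hV, inter_iUnion]
    exact cov_iUnion fun l => cov_local l
  have hVo : IsOpen V := by
    refine isOpen_iUnion fun l => isOpen_iff_cyl.2 fun x hx => ⟨l, fun y hy => ?_⟩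
    have hx : Cov k (X ∩ C) (S ∩ cyl x l) := hx
    change Cov k (X ∩ C) (S ∩ cyl y l)
    rwa [cyl_eq hy]
  set H := S ∩ Vᶜ with hH
  have hHG : IsGδ H := ((hG j).inter (closed_isGδ hC)).inter (closed_isGδ hVo.isClosed_compl)
  have hHcov : ∀ x ∈ closure H, ∀ n, ¬ Cov k (X ∩ C) (H ∩ cyl x n) := by
    intro x hx n hcov
    obtain ⟨y, hyc, hy⟩ := mem_closure_iff.1 hx _ (isOpen_cyl x n) (self_mem_cyl x n)
    apply hy.2
    refine mem_iUnion.2 ⟨n, ?_⟩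
    change Cov k (X ∩ C) (S ∩ cyl y n)
    rw [cyl_eq hyc]
    refine (cov_union hcov hVcov).mono ?_
    rintro z ⟨hz, hzc⟩
    by_cases hzV : z ∈ V
    · exact Or.inr ⟨hz, hzV⟩
    · exact Or.inl ⟨⟨hz, hzV⟩, hzc⟩
  have hHC : closure H ⊆ C := closure_minimal (fun x hx => hx.1.2) hC
  obtain ⟨O, hO, hHO⟩ := isGδ_iff_eq_iInter_nat.1 hHG
  refine ⟨⟨closure H, fun n => ⋃ i ∈ Finset.range (n + 1), (O i)ᶜ⟩, ⟨isClosed_closure, ?_, ?_, ?_, ?_, ?_⟩, ?_, hHC⟩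
  · intro i
    exact isClosed_biUnion_finset fun i _ => (hO i).isClosed_compl
  · intro a b hab
    refine biUnion_subset_biUnion_left ?_
    intro i hi
    simp only [Finset.coe_range, mem_Iio] at *
    omega
  · intro i x hx n
    obtain ⟨y, hyc, hy⟩ := mem_closure_iff.1 hx _ (isOpen_cyl x n) (self_mem_cyl x n)
    refine ⟨y, subset_closure hy, hyc, ?_⟩
    intro hyD
    simp only [mem_iUnion] at hyD
    obtain ⟨a, _, ha⟩ := hyD
    rw [hHO] at hy
    exact ha (mem_iInter.1 hy a)
  · rintro x ⟨hxX, hxE⟩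
    have : x ∉ H := by
      intro hx
      rw [hX] at hxX
      exact hxX (mem_iUnion.2 ⟨j, hx.1.1⟩)
    rw [hHO, mem_iInter] at this
    push Not at this
    obtain ⟨n, hn⟩ := this
    refine mem_iUnion.2 ⟨n, ?_⟩
    simp only [mem_iUnion]
    exact ⟨n, by simp, hn⟩
  · intro x hx n hsm
    apply hHcov x hx n
    refine ⟨fun _ => closure H ∩ cyl x n, fun _ => isClosed_closure.inter (isClosed_cyl x n), ?_, ?_⟩
    · rw [iUnion_const]
      exact inter_subset_inter_left _ subset_closure
    · rw [iUnion_const]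
      convert hsm using 1
      ext z
      constructor
      · rintro ⟨⟨a, b⟩, c, d⟩; exact ⟨⟨c, a⟩, b⟩
      · rintro ⟨⟨c, a⟩, b⟩; exact ⟨⟨a, b⟩, c, hHC a⟩
  · by_contra hne
    have hne : closure H = ∅ := not_nonempty_iff_eq_empty.1 hne
    apply hj
    refine hVcov.mono ?_
    intro z hz
    refine ⟨hz, ?_⟩
    by_contra hzV
    have : z ∈ closure H := subset_closure ⟨hz, hzV⟩
    rw [hne] at this
    exact this

theorem lemmaB {k : Cardinal.{u}} {X : Set (ℕ → T)} {G : ℕ → Set (ℕ → T)}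
    (hG : ∀ j, IsGδ (G j)) (hX : X = (⋃ j, G j)ᶜ) {E : Set (ℕ → T) × (ℕ → Set (ℕ → T))}
    (hE : Good k X E) {x : ℕ → T} (hx : x ∈ E.1) (n m : ℕ) :
    ∃ E', Good k X E' ∧ E'.1.Nonempty ∧ E'.1 ⊆ E.1 ∧ E'.1 ⊆ cyl x n ∧ E'.1 ⊆ (G m)ᶜ ∧
      ∃ i, E'.1 ⊆ E.2 i := by
  obtain ⟨O, hO, hGO⟩ := isGδ_iff_eq_iInter_nat.1 (hG m)
  have h : ∃ i l, ¬ Small k (X ∩ (E.1 ∩ cyl x n ∩ E.2 i ∩ (O l)ᶜ)) := by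
    by_contra hcon
    push Not at hcon
    apply hE.big x hx n
    have := small_iUnion fun i => small_iUnion fun l => hcon i l
    convert this using 1
    ext z
    simp only [mem_iUnion]
    constructor
    · rintro ⟨⟨a, b⟩, c⟩
      obtain ⟨i, hi⟩ := mem_iUnion.1 (hE.cover ⟨a, b⟩)
      have : z ∉ G m := by
        intro hz
        rw [hX] at a
        exact a (mem_iUnion.2 ⟨m, hz⟩)
      rw [hGO, mem_iInter] at this
      push Not at this
      obtain ⟨l, hl⟩ := this
      exact ⟨i, l, a, ⟨⟨b, c⟩, hi⟩, hl⟩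
    · rintro ⟨i, l, a, ⟨⟨b, c⟩, hi⟩, hl⟩
      exact ⟨⟨a, b⟩, c⟩
  obtain ⟨i, l, hil⟩ := h
  obtain ⟨E', h1, h2, h3⟩ := lemmaA hG hX
    (((hE.closed.inter (isClosed_cyl x n)).inter (hE.closedD i)).inter (hO l).isClosed_compl) hil
  refine ⟨E', h1, h2, fun z hz => (h3 hz).1.1.1, fun z hz => (h3 hz).1.1.2, fun z hz hz' => ?_, i,
    fun z hz => (h3 hz).1.2⟩
  rw [hGO] at hz'
  exact (h3 hz).2 (mem_iInter.1 hz' l)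

end Basic

section Family

variable {T : Type u} [TopologicalSpace T] [DiscreteTopology T]

theorem good_ne {k : Cardinal.{u}} {X : Set (ℕ → T)} {E : Set (ℕ → T) × (ℕ → Set (ℕ → T))}
    (hE : Good k X E) {p : ℕ → T} (hp : p ∈ E.1) (n : ℕ) : ∃ y ∈ E.1, y ∈ cyl p n ∧ y ≠ p := by
  by_contra hcon
  push Not at hcon
  apply hE.big p hp n
  have hsub : X ∩ E.1 ∩ cyl p n ⊆ {p} := fun z hz => hcon z hz.1.2 hz.2
  rcases subset_singleton_iff_eq.1 hsub with h | h
  · rw [h]; exact small_of_isGδ IsGδ.empty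
  · rw [h]; exact small_of_isGδ (closed_isGδ isClosed_singleton)

theorem good_notFew {k : Cardinal.{u}} {X : Set (ℕ → T)} {E : Set (ℕ → T) × (ℕ → Set (ℕ → T))}
    (hE : Good k X E) (hk : Cardinal.aleph0 < k) {p : ℕ → T} (hp : p ∈ E.1) (n : ℕ)
    (κ : Cardinal.{u}) (hκ : κ < k) : ∃ l, κ < Cardinal.mk (pref (E.1 ∩ cyl p n) l) := by
  by_contra hcon
  push Not at hcon
  apply hE.big p hp n
  refine small_of_few (Few.mono (Z' := E.1 ∩ cyl p n) ⟨hk, κ, hκ, hcon⟩ ?_)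
  exact fun z hz => ⟨hz.1.2, hz.2⟩

theorem cyl_meet {T : Type u} {x y : ℕ → T} {m n : ℕ} (h : (cyl x m ∩ cyl y n).Nonempty) {l : ℕ}
    (hm : l ≤ m) (hn : l ≤ n) : x ∈ cyl y l := by
  obtain ⟨z, hz1, hz2⟩ := h
  rw [← cyl_eq (cyl_anti y hn hz2), cyl_eq (cyl_anti x hm hz1)]
  exact self_mem_cyl _ _

theorem pref_choose {T : Type u} (Z : Set (ℕ → T)) (n : ℕ) :
    ∃ f : pref Z n → (ℕ → T), (∀ a, f a ∈ Z) ∧ ∀ a b, f a ∈ cyl (f b) n → a = b := by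
  have : ∀ a : pref Z n, ∃ x ∈ Z, (fun i : Fin n => x i) = a.1 := fun a => a.2
  choose f hf hfa using this
  refine ⟨f, hf, fun a b hab => ?_⟩
  apply Subtype.ext
  rw [← hfa a, ← hfa b]
  funext i
  exact hab i i.2

theorem family {k : Cardinal.{u}} {X : Set (ℕ → T)} {E : Set (ℕ → T) × (ℕ → Set (ℕ → T))}
    (hE : Good k X E) (hk : Cardinal.aleph0 < k) (hT : Cardinal.mk T = k) {p : ℕ → T}
    (hp : p ∈ E.1) (n : ℕ) : ∃ (q : T → (ℕ → T)) (L : T → ℕ),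
      (∀ t, q t ∈ E.1 ∧ q t ∈ cyl p n ∧ n ≤ L t) ∧
      ∀ z, ∃ l, ∀ t t', (cyl (q t) (L t) ∩ cyl z l).Nonempty →
        (cyl (q t') (L t') ∩ cyl z l).Nonempty → t = t' := by
  by_cases hcase : ∃ l, k ≤ Cardinal.mk (pref (E.1 ∩ cyl p n) l)
  · obtain ⟨l, hl⟩ := hcase
    rw [← hT] at hl
    obtain ⟨g⟩ := hl
    obtain ⟨f, hf, hfi⟩ := pref_choose (E.1 ∩ cyl p n) l
    refine ⟨fun t => f (g t), fun _ => max n l,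
      fun t => ⟨(hf _).1, (hf _).2, le_max_left _ _⟩, fun z => ⟨l, fun t t' h h' => ?_⟩⟩
    apply g.injective
    apply hfi
    have h1 := cyl_meet h (le_max_right n l) le_rfl
    have h2 := cyl_meet h' (le_max_right n l) le_rfl
    rw [cyl_eq h2]; exact h1
  · push Not at hcase
    obtain ⟨l0, hl0⟩ := good_notFew hE hk hp n _ hk
    have : Infinite (pref (E.1 ∩ cyl p n) l0) := Cardinal.infinite_iff.2 hl0.le
    let e := Infinite.natEmbedding (pref (E.1 ∩ cyl p n) l0)
    obtain ⟨f, hf, hfi⟩ := pref_choose (E.1 ∩ cyl p n) l0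
    have hw := fun i => good_notFew hE hk (hf (e i)).1 (max n l0) _ (hcase i)
    choose l hl using hw
    have hg : ∀ i, Nonempty (pref (E.1 ∩ cyl p n) i ↪
        pref (E.1 ∩ cyl (f (e i)) (max n l0)) (l i)) := fun i => (hl i).le
    have g := fun i => (hg i).some
    choose F hF hFi using fun i => pref_choose (E.1 ∩ cyl (f (e i)) (max n l0)) (l i)
    have hcard : Cardinal.mk T ≤ Cardinal.mk (Σ i : ℕ, pref (E.1 ∩ cyl p n) i) := by
      rw [hT]
      refine le_of_forall_lt fun κ hκ => ?_
      obtain ⟨i, hi⟩ := good_notFew hE hk hp n κ hκ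
      refine hi.trans_le ?_
      exact ⟨⟨fun a => ⟨i, a⟩, fun a b h => by simpa using h⟩⟩
    obtain ⟨d⟩ := hcard
    refine ⟨fun t => F (d t).1 (g (d t).1 (d t).2), fun t => max (max n l0) (l (d t).1), ?_, ?_⟩
    · intro t
      refine ⟨(hF _ _).1, ?_, (le_max_left _ _).trans (le_max_left _ _)⟩
      exact cyl_sub (le_max_left n l0) (hf _).2 (hF _ _).2
    · intro z
      have hz : ∀ l', l0 ≤ l' → ∀ t, (cyl (F (d t).1 (g (d t).1 (d t).2))
          (max (max n l0) (l (d t).1)) ∩ cyl z l').Nonempty → f (e (d t).1) ∈ cyl z l0 := by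
        intro l' hl' t h
        have h1 := cyl_meet h ((le_max_right n l0).trans (le_max_left _ _)) hl'
        have h2 := cyl_anti _ (le_max_right n l0) (hF (d t).1 (g (d t).1 (d t).2)).2
        rw [← cyl_eq h1, cyl_eq h2]; exact self_mem_cyl _ _
      by_cases hi : ∃ i, f (e i) ∈ cyl z l0
      · obtain ⟨i, hi⟩ := hi
        have hu : ∀ j, f (e j) ∈ cyl z l0 → j = i := by
          intro j hj
          apply e.injective
          apply hfi
          rw [cyl_eq hi]; exact hj
        refine ⟨max l0 (l i), fun t t' h h' => ?_⟩
        have e1 := hu _ (hz _ (le_max_left _ _) t h)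
        have e2 := hu _ (hz _ (le_max_left _ _) t' h')
        apply d.injective
        beta_reduce at h h'
        generalize d t = a at *
        generalize d t' = b at *
        obtain ⟨i1, a⟩ := a
        obtain ⟨i2, b⟩ := b
        dsimp only at *
        subst e1
        subst e2
        congr 1
        apply (g _).injective
        apply hFi
        have h1 := cyl_meet h (le_max_right _ _) (le_max_right _ _)
        have h2 := cyl_meet h' (le_max_right _ _) (le_max_right _ _)
        rw [cyl_eq h2]; exact h1
      · refine ⟨l0, fun t t' h h' => ?_⟩
        exact (hi ⟨_, hz _ le_rfl t h⟩).elim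

theorem lemmaG {k : Cardinal.{u}} {X : Set (ℕ → T)} {E : Set (ℕ → T) × (ℕ → Set (ℕ → T))}
    (hE : Good k X E) (t0 : T)
    (hT : (∃ t1, ∀ t, t ≠ t0 → t = t1) ∨ (Cardinal.aleph0 < k ∧ Cardinal.mk T = k)) {p : ℕ → T}
    (hp : p ∈ E.1) (n : ℕ) : ∃ (q : T → (ℕ → T)) (L : T → ℕ), q t0 = p ∧
      (∀ t, q t ∈ E.1 ∧ q t ∈ cyl p n ∧ n ≤ L t) ∧
      ∀ z, ∃ l, ∀ t t', (cyl (q t) (L t) ∩ cyl z l).Nonempty →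
        (cyl (q t') (L t') ∩ cyl z l).Nonempty → t = t' := by
  classical
  obtain ⟨y, hy, hyp, hne⟩ := good_ne hE hp n
  obtain ⟨a, ha⟩ := Function.ne_iff.1 hne
  set M := max n (a + 1) with hM
  have hnot : y ∉ cyl p M := fun h => ha (h a (by omega))
  have key : ∃ (q : T → (ℕ → T)) (L : T → ℕ),
      (∀ t, q t ∈ E.1 ∧ q t ∈ cyl y M ∧ M ≤ L t) ∧
      ∀ z, ∃ l, ∀ t t', t ≠ t0 → t' ≠ t0 → (cyl (q t) (L t) ∩ cyl z l).Nonempty →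
        (cyl (q t') (L t') ∩ cyl z l).Nonempty → t = t' := by
    rcases hT with ⟨t1, h1⟩ | ⟨h1, h2⟩
    · refine ⟨fun _ => y, fun _ => M, fun t => ⟨hy, self_mem_cyl _ _, le_rfl⟩,
        fun z => ⟨0, fun t t' h h' _ _ => ?_⟩⟩
      rw [h1 t h, h1 t' h']
    · obtain ⟨q, L, h3, h4⟩ := family hE h1 h2 hy M
      refine ⟨q, L, h3, fun z => ?_⟩
      obtain ⟨l, hl⟩ := h4 z
      exact ⟨l, fun t t' _ _ => hl t t'⟩
  obtain ⟨q, L, h1, h2⟩ := key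
  refine ⟨fun t => if t = t0 then p else q t, fun t => if t = t0 then M else L t, by simp, ?_, ?_⟩
  · intro t
    by_cases ht : t = t0
    · simp only [ht, if_true]
      exact ⟨hp, self_mem_cyl _ _, le_max_left _ _⟩
    · simp only [ht, if_false]
      refine ⟨(h1 t).1, ?_, (le_max_left _ _).trans (h1 t).2.2⟩
      rw [← cyl_eq hyp]
      exact cyl_anti _ (le_max_left _ _) (h1 t).2.1
  · intro z
    obtain ⟨l, hl⟩ := h2 z
    refine ⟨max l M, fun t t' h h' => ?_⟩
    have aux : ∀ s, s ≠ t0 → (cyl (q s) (L s) ∩ cyl z (max l M)).Nonempty → y ∈ cyl z M := by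
      intro s hs h
      have := cyl_meet h (h1 s).2.2 (le_max_right _ _)
      rw [← cyl_eq this, cyl_eq (h1 s).2.1]; exact self_mem_cyl _ _
    have aux2 : (cyl p M ∩ cyl z (max l M)).Nonempty → y ∈ cyl z M → False := by
      intro h h'
      have := cyl_meet h le_rfl (le_max_right _ _)
      rw [← cyl_eq this] at h'
      exact hnot h'
    by_cases ht : t = t0 <;> by_cases ht' : t' = t0
    · rw [ht, ht']
    · simp only [ht, ht', if_true, if_false] at h h'
      exact (aux2 h (aux _ ht' h')).elim
    · simp only [ht, ht', if_true, if_false] at h h'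
      exact (aux2 h' (aux _ ht h)).elim
    · simp only [ht, ht', if_false] at h h'
      refine hl t t' ht ht' (h.mono ?_) (h'.mono ?_) <;>
      exact inter_subset_inter_right _ (cyl_anti z (le_max_left _ _))

end Family

section Construction

variable {T : Type u} [TopologicalSpace T] [DiscreteTopology T]

/-- Chains of pairs (closed set, sequence of closed sets). -/
abbrev Chain (T : Type u) := ℕ → Set (ℕ → T) × (ℕ → Set (ℕ → T))

/-- The chain is as required up to index `n`. -/
structure Valid (k : Cardinal.{u}) (X : Set (ℕ → T)) (G : ℕ → Set (ℕ → T)) (c : Chain T) (n : ℕ) :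
    Prop where
  good : ∀ i ≤ n, Good k X (c i)
  anti : ∀ i < n, (c (i + 1)).1 ⊆ (c i).1
  sub : ∀ i < n, (c (i + 1)).1 ⊆ (G i)ᶜ

theorem Valid.le {k : Cardinal.{u}} {X : Set (ℕ → T)} {G : ℕ → Set (ℕ → T)} {c : Chain T}
    {m n : ℕ} (h : Valid k X G c n) (hm : m ≤ n) : Valid k X G c m :=
  ⟨fun i hi => h.good i (hi.trans hm), fun i hi => h.anti i (hi.trans_le hm),
    fun i hi => h.sub i (hi.trans_le hm)⟩

theorem Valid.subset {k : Cardinal.{u}} {X : Set (ℕ → T)} {G : ℕ → Set (ℕ → T)} {c : Chain T}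
    {m n : ℕ} (h : Valid k X G c n) (hm : m ≤ n) : (c n).1 ⊆ (c m).1 := by
  induction n, hm using Nat.le_induction with
  | base => exact subset_rfl
  | succ n hmn ih => exact (h.anti n n.lt_succ_self).trans (ih (h.le n.le_succ))

theorem extend {k : Cardinal.{u}} {X : Set (ℕ → T)} {G : ℕ → Set (ℕ → T)}
    (hG : ∀ j, IsGδ (G j)) (hX : X = (⋃ j, G j)ᶜ) {c : Chain T} {m : ℕ}
    (h : Valid k X G c m) {p : ℕ → T} (hp : p ∈ (c m).1) (N j : ℕ) :
    ∃ (c' : Chain T) (p' : ℕ → T), Valid k X G c' (m + j) ∧ (∀ i ≤ m, c' i = c i) ∧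
      p' ∈ (c' (m + j)).1 ∧ p' ∈ cyl p N := by
  induction j with
  | zero => exact ⟨c, p, h, fun _ _ => rfl, hp, self_mem_cyl _ _⟩
  | succ j ih =>
    obtain ⟨c', p', h1, h2, h3, h4⟩ := ih
    obtain ⟨E, hE, ⟨y, hy⟩, hs1, hs2, hs3, -⟩ := lemmaB hG hX (h1.good _ le_rfl) h3 N (m + j)
    have hup : ∀ i ≤ m + j, Function.update c' (m + j + 1) E i = c' i := fun i hi =>
      Function.update_of_ne (by omega) _ _
    have hup' : Function.update c' (m + j + 1) E (m + j + 1) = E := Function.update_self _ _ _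
    refine ⟨Function.update c' (m + j + 1) E, y, ⟨?_, ?_, ?_⟩, ?_, ?_, ?_⟩
    · intro i hi
      rcases Nat.lt_or_ge i (m + j + 1) with hlt | hge
      · rw [hup i (by omega)]; exact h1.good i (by omega)
      · obtain rfl : i = m + j + 1 := by omega
        rw [hup']; exact hE
    · intro i hi
      rcases Nat.lt_or_ge i (m + j) with hlt | hge
      · rw [hup i (by omega), hup (i + 1) (by omega)]; exact h1.anti i (by omega)
      · obtain rfl : i = m + j := by omega
        rw [hup', hup _ le_rfl]; exact hs1
    · intro i hi
      rcases Nat.lt_or_ge i (m + j) with hlt | hge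
      · rw [hup (i + 1) (by omega)]; exact h1.sub i (by omega)
      · obtain rfl : i = m + j := by omega
        rw [hup']; exact hs3
    · intro i hi
      rw [hup i (by omega), h2 i hi]
    · change y ∈ (Function.update c' (m + j + 1) E (m + j + 1)).1
      rw [hup']; exact hy
    · rw [← cyl_eq h4]; exact hs2 hy

/-- A state of the construction. -/
structure St (T : Type u) where
  c : Chain T
  p : ℕ → T
  N : ℕ

/-- The cylinder of a state. -/
def St.U {T : Type u} (s : St T) : Set (ℕ → T) := cyl s.p s.N

/-- The state is as required at stage `n`. -/
structure St.OK (k : Cardinal.{u}) (X : Set (ℕ → T)) (G : ℕ → Set (ℕ → T)) (n : ℕ) (s : St T) :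
    Prop where
  valid : Valid k X G s.c n
  mem : s.p ∈ (s.c n).1
  le : n ≤ s.N

/-- The row of a coordinate. -/
def row (n : ℕ) : ℕ := n.unpair.1

theorem row_le (n : ℕ) : row n ≤ n := Nat.unpair_left_le n

/-- The properties of the successors of a state at stage `n`. -/
structure StepOK (k : Cardinal.{u}) (X : Set (ℕ → T)) (G : ℕ → Set (ℕ → T)) (t0 : T) (n : ℕ)
    (s : St T) (f : T → St T) : Prop where
  ok : ∀ t, (f t).OK k X G (n + 1)
  sub : ∀ t, (f t).U ⊆ s.U
  disc : ∀ z, ∃ l, ∀ t t', ((f t).U ∩ cyl z l).Nonempty → ((f t').U ∩ cyl z l).Nonempty → t = t'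
  keep : ∀ t, ∀ i ≤ row n, (f t).c i = s.c i
  keep0 : ∀ i ≤ n, (f t0).c i = s.c i
  avoid : ∀ t ≠ t0, Disjoint (f t).U ((s.c (row n)).2 n)

theorem step_exists {k : Cardinal.{u}} {X : Set (ℕ → T)} {G : ℕ → Set (ℕ → T)}
    (hG : ∀ j, IsGδ (G j)) (hX : X = (⋃ j, G j)ᶜ) (t0 : T)
    (hT : (∃ t1, ∀ t, t ≠ t0 → t = t1) ∨ (Cardinal.aleph0 < k ∧ Cardinal.mk T = k))
    (n : ℕ) (s : St T) (hs : s.OK k X G n) : ∃ f : T → St T, StepOK k X G t0 n s f := by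
  have hm := row_le n
  have hgood := hs.valid.good _ hm
  obtain ⟨q, L, hq0, hq, hdisc⟩ := lemmaG hgood t0 hT (hs.valid.subset hm hs.mem) (max s.N (n + 1))
  have key : ∀ t, ∃ s' : St T, s'.OK k X G (n + 1) ∧ s'.U ⊆ cyl (q t) (L t) ∧
      (∀ i ≤ row n, s'.c i = s.c i) ∧ (t = t0 → ∀ i ≤ n, s'.c i = s.c i) ∧
      (t ≠ t0 → Disjoint s'.U ((s.c (row n)).2 n)) := by
    intro t
    have hLt := (hq t).2.2
    by_cases ht : t = t0
    · obtain ⟨c', p', h1, h2, h3, h4⟩ := extend hG hX hs.valid hs.mem (L t) 1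
      refine ⟨⟨c', p', L t⟩, ⟨h1, h3, ?_⟩, ?_, fun i hi => h2 i (hi.trans hm), fun _ => h2,
        fun h => (h ht).elim⟩
      · change n + 1 ≤ L t
        omega
      · change cyl p' (L t) ⊆ _
        rw [cyl_eq h4, ht, hq0]
    · obtain ⟨y, hy, hyc, hyD⟩ := hgood.nwd n (q t) (hq t).1 (L t)
      obtain ⟨M, hM, hMs⟩ := exists_cyl_sub (hgood.closedD n).isOpen_compl hyD (L t)
      obtain ⟨c', p', h1, h2, h3, h4⟩ := extend hG hX (hs.valid.le hm) hy M (n + 1 - row n)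
      have he : row n + (n + 1 - row n) = n + 1 := by omega
      rw [he] at h1 h3
      refine ⟨⟨c', p', M⟩, ⟨h1, h3, ?_⟩, ?_, fun i hi => h2 i hi, fun h => (ht h).elim, fun _ => ?_⟩
      · change n + 1 ≤ M
        omega
      · change cyl p' M ⊆ _
        rw [cyl_eq h4]
        exact cyl_sub hM hyc
      · change Disjoint (cyl p' M) _
        rw [cyl_eq h4]
        exact disjoint_left.2 fun z hz => hMs hz
  choose f h1 h2 h3 h4 h5 using key
  refine ⟨f, ⟨h1, fun t => ?_, fun z => ?_, h3, h4 t0 rfl, h5⟩⟩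
  · refine (h2 t).trans ((cyl_sub (hq t).2.2 (hq t).2.1).trans ?_)
    exact cyl_anti _ (le_max_left _ _)
  · obtain ⟨l, hl⟩ := hdisc z
    refine ⟨l, fun t t' h h' => hl t t' (h.mono ?_) (h'.mono ?_)⟩ <;>
    exact inter_subset_inter_left _ (h2 _)

/-- The sequence of states along `x`. -/
def state (step : ℕ → St T → T → St T) (s0 : St T) (x : ℕ → T) : ℕ → St T
  | 0 => s0
  | n + 1 => step n (state step s0 x n) (x n)

theorem state_congr {step : ℕ → St T → T → St T} {s0 : St T} {x y : ℕ → T} {n : ℕ}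
    (h : y ∈ cyl x n) : state step s0 y n = state step s0 x n := by
  induction n with
  | zero => rfl
  | succ n ih =>
    simp only [state]
    rw [ih (cyl_anti x n.le_succ h), h n n.lt_succ_self]

/-- The limit map. -/
def lim (step : ℕ → St T → T → St T) (s0 : St T) (x : ℕ → T) : ℕ → T :=
  fun i => (state step s0 x (i + 1)).p i

theorem main_embedding {k : Cardinal.{u}} {X : Set (ℕ → T)} {G : ℕ → Set (ℕ → T)}
    (hG : ∀ j, IsGδ (G j)) (hX : X = (⋃ j, G j)ᶜ) (t0 : T)
    (hT : (∃ t1, ∀ t, t ≠ t0 → t = t1) ∨ (Cardinal.aleph0 < k ∧ Cardinal.mk T = k))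
    {E : Set (ℕ → T) × (ℕ → Set (ℕ → T))} (hE : Good k X E) (hne : E.1.Nonempty) :
    ∃ h : (ℕ → T) → (ℕ → T), IsClosedEmbedding h ∧ range h ⊆ E.1 ∧
      ∀ x, h x ∈ X ↔ ∀ m, ∀ᶠ n in atTop, row n = m → x n = t0 := by
  classical
  obtain ⟨p0, hp0⟩ := hne
  let s0 : St T := ⟨fun _ => E, p0, 0⟩
  have hs0 : s0.OK k X G 0 :=
    ⟨⟨fun _ _ => hE, fun i hi => by omega, fun i hi => by omega⟩, hp0, le_rfl⟩
  have hstep : ∀ n s, ∃ f : T → St T, s.OK k X G n → StepOK k X G t0 n s f := by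
    intro n s
    by_cases h : s.OK k X G n
    · obtain ⟨f, hf⟩ := step_exists hG hX t0 hT n s h
      exact ⟨f, fun _ => hf⟩
    · exact ⟨fun _ => s, fun h' => (h h').elim⟩
  choose step hstep using hstep
  let σ := state step s0
  have hok : ∀ x n, (σ x n).OK k X G n := by
    intro x n
    induction n with
    | zero => exact hs0
    | succ n ih => exact (hstep n _ ih).ok (x n)
  have hst : ∀ x n, StepOK k X G t0 n (σ x n) (step n (σ x n)) := fun x n => hstep n _ (hok x n)
  have hσ : ∀ x n, σ x (n + 1) = step n (σ x n) (x n) := fun x n => rfl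
  have hanti : ∀ x m n, m ≤ n → (σ x n).U ⊆ (σ x m).U := by
    intro x m n hmn
    induction n, hmn using Nat.le_induction with
    | base => exact subset_rfl
    | succ n _ ih => exact ((hst x n).sub (x n)).trans ih
  have hpU : ∀ x m n, m ≤ n → (σ x n).p ∈ (σ x m).U := fun x m n hmn =>
    hanti x m n hmn (self_mem_cyl _ _)
  let h := lim step s0
  have hh : ∀ x i, h x i = (σ x (i + 1)).p i := fun x i => rfl
  have hmem : ∀ x n, h x ∈ (σ x n).U := by
    intro x n i hi
    rw [hh]
    have h1 := hpU x n (max n (i + 1)) (le_max_left _ _) i hi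
    have h2 := hpU x (i + 1) (max n (i + 1)) (le_max_right _ _) i
      (Nat.lt_of_lt_of_le i.lt_succ_self (hok x (i + 1)).le)
    rw [← h1, ← h2]
  have huniq : ∀ n x z y, y ∈ (σ x n).U → y ∈ (σ z n).U → z ∈ cyl x n := by
    intro n
    induction n with
    | zero => intro x z y _ _ i hi; omega
    | succ n ih =>
      intro x z y hx hz i hi
      have hzx := ih x z y ((hst x n).sub _ hx) ((hst z n).sub _ hz)
      rcases Nat.lt_or_ge i n with hlt | hge
      · exact hzx i hlt
      · obtain rfl : i = n := by omega
        have he : σ z i = σ x i := state_congr hzx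
        obtain ⟨l, hl⟩ := (hst x i).disc y
        rw [hσ] at hx hz
        rw [he] at hz
        exact hl _ _ ⟨y, hz, self_mem_cyl _ _⟩ ⟨y, hx, self_mem_cyl _ _⟩
  have hlim : ∀ x n, h x ∈ cyl (σ x n).p n := fun x n => cyl_anti _ (hok x n).le (hmem x n)
  have heq : ∀ x y, (∀ n, y ∈ (σ x n).U) → y = h x := by
    intro x y hy
    funext i
    have h1 := cyl_anti _ (hok x (i + 1)).le (hy (i + 1)) i i.lt_succ_self
    have h2 := hlim x (i + 1) i i.lt_succ_self
    rw [h1, h2]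
  have hcont : Continuous h := by
    refine continuous_pi fun i => ?_
    refine (IsLocallyConstant.iff_exists_open _).2 (fun x => ⟨cyl x (i + 1), isOpen_cyl _ _,
      self_mem_cyl _ _, fun y hy => ?_⟩) |>.continuous
    change (state step s0 y (i + 1)).p i = (state step s0 x (i + 1)).p i
    rw [state_congr hy]
  have hinj : Function.Injective h := by
    intro x z hxz
    funext i
    refine (huniq (i + 1) z x (h x) ?_ (hmem x _) i i.lt_succ_self)
    rw [hxz]; exact hmem z _
  have hind : IsInducing h := by
    refine isInducing_iff_nhds.2 fun x => le_antisymm (hcont.tendsto x).le_comap ?_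
    intro s hs
    obtain ⟨V, hVs, hVo, hxV⟩ := mem_nhds_iff.1 hs
    obtain ⟨n, -, hn⟩ := exists_cyl_sub hVo hxV 0
    refine ⟨(σ x n).U, (isOpen_cyl _ _).mem_nhds (hmem x n), fun z hz => hVs (hn ?_)⟩
    exact huniq n x z (h z) hz (hmem z n)
  have hUc : ∀ n, IsClosed (⋃ x, (σ x n).U) := by
    intro n
    induction n with
    | zero =>
      have : (⋃ x, (σ x 0).U) = s0.U := by
        have : ∀ x, (σ x 0).U = s0.U := fun x => rfl
        simp only [this]
        have : Nonempty (ℕ → T) := ⟨p0⟩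
        exact iUnion_const _
      rw [this]; exact isClosed_cyl _ _
    | succ n ih =>
      rw [← isOpen_compl_iff, isOpen_iff_cyl]
      intro y hy
      by_cases hyn : y ∈ ⋃ x, (σ x n).U
      · obtain ⟨x, hx⟩ := mem_iUnion.1 hyn
        obtain ⟨l, hl⟩ := (hst x n).disc y
        obtain ⟨a, -, ha⟩ := exists_cyl_sub (isOpen_cyl _ _) hx 0
        have hsub : ∀ z w, w ∈ (σ z (n + 1)).U → w ∈ cyl y a → w ∈ (step n (σ x n) (z n)).U := by
          intro z w hw hwa
          have hzx := huniq n x z w (ha hwa) ((hst z n).sub _ hw)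
          have he : σ z n = σ x n := state_congr hzx
          rw [hσ, he] at hw
          exact hw
        by_cases hex : ∃ t, ((step n (σ x n) t).U ∩ cyl y l).Nonempty
        · obtain ⟨t, ht⟩ := hex
          have hyt : y ∉ (step n (σ x n) t).U := by
            intro hyt
            apply hy
            refine mem_iUnion.2 ⟨Function.update x n t, ?_⟩
            rw [hσ]
            have he : σ (Function.update x n t) n = σ x n := state_congr fun i hi =>
              Function.update_of_ne (by omega) _ _
            rw [he, Function.update_self]
            exact hyt
          obtain ⟨b, -, hb⟩ := exists_cyl_sub (isClosed_cyl (step n (σ x n) t).p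
            (step n (σ x n) t).N).isOpen_compl hyt 0
          refine ⟨max a (max b l), fun w hw hwu => ?_⟩
          obtain ⟨z, hz⟩ := mem_iUnion.1 hwu
          have h1 := hsub z w hz (cyl_anti _ (le_max_left _ _) hw)
          have h2 : z n = t := hl _ _
            ⟨w, h1, cyl_anti _ ((le_max_right _ _).trans (le_max_right _ _)) hw⟩ ht
          rw [h2] at h1
          exact hb (cyl_anti _ ((le_max_left _ _).trans (le_max_right _ _)) hw) h1
        · refine ⟨max a l, fun w hw hwu => hex ?_⟩
          obtain ⟨z, hz⟩ := mem_iUnion.1 hwu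
          exact ⟨z n, w, hsub z w hz (cyl_anti _ (le_max_left _ _) hw),
            cyl_anti _ (le_max_right _ _) hw⟩
      · obtain ⟨a, -, ha⟩ := exists_cyl_sub ih.isOpen_compl hyn 0
        refine ⟨a, fun w hw hwu => ha hw ?_⟩
        obtain ⟨z, hz⟩ := mem_iUnion.1 hwu
        exact mem_iUnion.2 ⟨z, (hst z n).sub _ hz⟩
  have hrange : IsClosed (range h) := by
    refine isClosed_of_closure_subset fun y hy => ?_
    have h1 : ∀ n, ∃ x, y ∈ (σ x n).U := by
      intro n
      refine mem_iUnion.1 (closure_minimal ?_ (hUc n) hy)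
      rintro _ ⟨x, rfl⟩
      exact mem_iUnion.2 ⟨x, hmem x n⟩
    choose xs hxs using h1
    let x : ℕ → T := fun i => xs (i + 1) i
    have hx : ∀ n, x ∈ cyl (xs n) n := by
      intro n i hi
      exact huniq (i + 1) (xs n) (xs (i + 1)) y (hanti _ _ _ hi (hxs n)) (hxs _) i i.lt_succ_self
    refine ⟨x, (heq x y fun n => ?_).symm⟩
    have he : σ x n = σ (xs n) n := state_congr (hx n)
    rw [he]; exact hxs n
  have hstab : ∀ x j, (∀ᶠ n in atTop, x n ≠ t0 → j ≤ row n) → ∃ n1, j ≤ n1 ∧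
      (∀ n ≥ n1, (σ x n).c j = (σ x n1).c j) ∧ h x ∈ ((σ x n1).c j).1 := by
    intro x j hj
    obtain ⟨n0, hn0⟩ := eventually_atTop.1 hj
    have hc : ∀ n ≥ max n0 j, (σ x n).c j = (σ x (max n0 j)).c j := by
      intro n hn
      induction n, hn using Nat.le_induction with
      | base => rfl
      | succ n hn ih =>
        rw [← ih, hσ]
        by_cases hx : x n = t0
        · rw [hx]; exact (hst x n).keep0 j ((le_max_right _ _).trans hn)
        · exact (hst x n).keep _ j (hn0 n ((le_max_left _ _).trans hn) hx)
    refine ⟨max n0 j, le_max_right _ _, hc, ?_⟩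
    refine mem_of_closed ((hok x (max n0 j)).valid.good j (le_max_right _ _)).closed fun n => ?_
    refine ⟨(σ x (max n (max n0 j))).p, ?_, ?_⟩
    · rw [← hc _ (le_max_right n _)]
      exact (hok x _).valid.subset ((le_max_right n0 j).trans (le_max_right _ _)) (hok x _).mem
    · have := cyl_anti _ (le_max_left n (max n0 j)) (hlim x (max n (max n0 j)))
      rw [cyl_eq this]; exact self_mem_cyl _ _
  have hfin : ∀ (x : ℕ → T) (j : ℕ), (∀ m < j, ∀ᶠ n in atTop, row n = m → x n = t0) →
      ∀ᶠ n in atTop, x n ≠ t0 → j ≤ row n := by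
    intro x j hj
    have := (eventually_all_finite (finite_lt_nat j)).2 hj
    filter_upwards [this] with n hn hx
    by_contra hlt
    exact hx (hn (row n) (not_le.1 hlt) rfl)
  refine ⟨h, ⟨⟨hind, hinj⟩, hrange⟩, ?_, ?_⟩
  · rintro _ ⟨x, rfl⟩
    obtain ⟨n1, -, -, h3⟩ := hstab x 0 (Eventually.of_forall fun n _ => Nat.zero_le _)
    have : ∀ n, (σ x n).c 0 = E := by
      intro n
      induction n with
      | zero => rfl
      | succ n ih => rw [hσ, (hst x n).keep _ 0 (Nat.zero_le _), ih]
    rwa [this] at h3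
  · intro x
    constructor
    · intro hxX
      by_contra hcon
      push Not at hcon
      have hmin := Nat.find_spec hcon
      have hlt : ∀ m < Nat.find hcon, ∀ᶠ n in atTop, row n = m → x n = t0 := fun m hm => by
        have := Nat.find_min hcon hm
        simpa [Filter.Frequently] using this
      set m := Nat.find hcon
      obtain ⟨n1, h1, h2, h3⟩ := hstab x m (hfin x m hlt)
      have hgood := (hok x n1).valid.good m h1
      obtain ⟨i, hi⟩ := mem_iUnion.1 (hgood.cover ⟨hxX, h3⟩)
      obtain ⟨n, hn, hrow, hxn⟩ := frequently_atTop.1 hmin (max n1 i)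
      have hav := (hst x n).avoid (x n) hxn
      rw [hrow, h2 n ((le_max_left _ _).trans hn)] at hav
      exact disjoint_left.1 hav (hmem x (n + 1)) (hgood.mono ((le_max_right _ _).trans hn) hi)
    · intro hx
      rw [hX]
      intro hcon
      obtain ⟨m, hm⟩ := mem_iUnion.1 hcon
      obtain ⟨n1, h1, -, h3⟩ := hstab x (m + 1) (hfin x (m + 1) fun m _ => hx m)
      exact (hok x n1).valid.sub m h1 h3 hm

end Construction

section Classes

variable {T : Type u} [TopologicalSpace T] [DiscreteTopology T]

theorem isFsigma_of_isClosed {M : Type*} [TopologicalSpace M] {s : Set M} (h : IsClosed s) :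
    IsFsigmaSet s := ⟨fun _ => s, fun _ => h, (iUnion_const _).symm⟩

theorem isFsigma_of_isOpen {M : Type*} [TopologicalSpace M] [TopologicalSpace.MetrizableSpace M]
    {s : Set M} (h : IsOpen s) : IsFsigmaSet s := by
  let _ := TopologicalSpace.metrizableSpaceMetric M
  obtain ⟨F, h1, -, h3, -⟩ := h.exists_iUnion_isClosed
  exact ⟨F, h1, h3.symm⟩

theorem isFsigmaDelta_iInter_sum {M : Type*} [TopologicalSpace M] {A B : ℕ → Set M}
    (hA : ∀ n, IsFsigmaSet (A n)) (hB : ∀ n, IsFsigmaSet (B n)) :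
    IsFsigmaDelta ((⋂ n, A n) ∩ ⋂ n, B n) := by
  refine ⟨fun n => if Even n then A (n / 2) else B (n / 2), fun n => ?_, ?_⟩
  · dsimp only
    split_ifs
    · exact hA _
    · exact hB _
  · ext x
    simp only [mem_inter_iff, mem_iInter]
    constructor
    · rintro ⟨h1, h2⟩ n
      split_ifs
      · exact h1 _
      · exact h2 _
    · intro h
      refine ⟨fun n => ?_, fun n => ?_⟩
      · have := h (2 * n)
        rw [if_pos (by simp)] at this
        rwa [Nat.mul_div_cancel_left _ (by norm_num)] at this
      · have := h (2 * n + 1)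
        rw [if_neg (by simp)] at this
        have e : (2 * n + 1) / 2 = n := by omega
        rwa [e] at this

theorem absFsigmaDelta {F : Set (ℕ → T)} (hF : IsFsigmaDelta F) : AbsFsigmaDelta ↥F := by
  refine ⟨inferInstance, ?_⟩
  intro M _ _ f hf
  obtain ⟨D, hD, hFD⟩ := hF
  choose C hC hDC using hD
  let G : ℕ → Set M := fun n => ⋃₀ {V | IsOpen V ∧ ∀ a b : ↥F, f a ∈ V → f b ∈ V → a.1 n = b.1 n}
  let K : ℕ → Set M := fun n => ⋃ i, closure (f '' {x | x.1 ∈ C n i})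
  have hG : ∀ n, IsFsigmaSet (G n) := fun n =>
    isFsigma_of_isOpen (isOpen_sUnion fun V hV => hV.1)
  have hK : ∀ n, IsFsigmaSet (K n) := fun n => ⟨_, fun i => isClosed_closure, rfl⟩
  have key : range f = (⋂ n, G n) ∩ ⋂ n, K n := by
    apply Subset.antisymm
    · rintro _ ⟨x, rfl⟩
      refine ⟨mem_iInter.2 fun n => ?_, mem_iInter.2 fun n => ?_⟩
      · have ho : IsOpen {a : ↥F | a.1 n = x.1 n} :=
          (isOpen_discrete ({x.1 n} : Set T)).preimage
            (f := fun a : ↥F => a.1 n)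
            ((continuous_pi_iff.1 continuous_id n).comp continuous_subtype_val)
        obtain ⟨V, hV, hVe⟩ := hf.isInducing.isOpen_iff.1 ho
        have hmem : ∀ a : ↥F, f a ∈ V ↔ a.1 n = x.1 n := fun a => by
          have : a ∈ f ⁻¹' V ↔ a ∈ {a : ↥F | a.1 n = x.1 n} := by rw [hVe]
          exact this
        refine mem_sUnion.2 ⟨V, ⟨hV, fun a b ha hb => ?_⟩, (hmem x).2 rfl⟩
        rw [(hmem a).1 ha, (hmem b).1 hb]
      · have hx : ∀ y ∈ F, ∀ n, y ∈ D n := fun y hy => by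
          rw [hFD] at hy
          exact mem_iInter.1 hy
        have := hx x.1 x.2 n
        rw [hDC] at this
        obtain ⟨i, hi⟩ := mem_iUnion.1 this
        exact mem_iUnion.2 ⟨i, subset_closure ⟨x, hi, rfl⟩⟩
    · rintro y ⟨hy1, hy2⟩
      rw [mem_iInter] at hy1 hy2
      have hV : ∀ n, ∃ V : Set M, y ∈ V ∧ IsOpen V ∧
          ∀ a b : ↥F, f a ∈ V → f b ∈ V → a.1 n = b.1 n := by
        intro n
        obtain ⟨V, ⟨h1, h2⟩, h3⟩ := mem_sUnion.1 (hy1 n)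
        exact ⟨V, h3, h1, h2⟩
      choose V hyV hVo hVc using hV
      have hcl : y ∈ closure (range f) := by
        obtain ⟨i, hi⟩ := mem_iUnion.1 (hy2 0)
        exact closure_mono (image_subset_range _ _) hi
      have ha : ∀ n, ∃ a : ↥F, f a ∈ V n := by
        intro n
        obtain ⟨_, h1, ⟨a, rfl⟩⟩ := mem_closure_iff.1 hcl (V n) (hVo n) (hyV n)
        exact ⟨a, h1⟩
      choose a ha using ha
      let g : ℕ → T := fun n => (a n).1 n
      let W : ℕ → Set M := fun N => ⋂ n ∈ Finset.range N, V n
      have hWo : ∀ N, IsOpen (W N) := fun N => isOpen_biInter_finset fun n _ => hVo n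
      have hyW : ∀ N, y ∈ W N := fun N => mem_iInter₂.2 fun n _ => hyV n
      have hWc : ∀ N (b : ↥F), f b ∈ W N → b.1 ∈ cyl g N := by
        intro N b hb n hn
        exact hVc n b (a n) (mem_iInter₂.1 hb n (Finset.mem_range.2 hn)) (ha n)
      have hgF : g ∈ F := by
        rw [hFD, mem_iInter]
        intro n
        rw [hDC]
        obtain ⟨i, hi⟩ := mem_iUnion.1 (hy2 n)
        refine mem_iUnion.2 ⟨i, mem_of_closed (hC n i) fun N => ?_⟩
        obtain ⟨_, h1, ⟨b, hb, rfl⟩⟩ := mem_closure_iff.1 hi (W N) (hWo N) (hyW N)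
        exact ⟨b.1, hb, hWc N b h1⟩
      refine ⟨⟨g, hgF⟩, ?_⟩
      by_contra hne
      obtain ⟨U, U', hU, hU', h1, h2, hd⟩ := t2_separation hne
      obtain ⟨O, hO, hOe⟩ := isOpen_induced_iff.1 (hU.preimage hf.continuous)
      have hgO : g ∈ O := by
        have : (⟨g, hgF⟩ : ↥F) ∈ Subtype.val ⁻¹' O := by rw [hOe]; exact h1
        exact this
      obtain ⟨N, -, hN⟩ := exists_cyl_sub hO hgO 0
      obtain ⟨_, h3, ⟨b, rfl⟩⟩ := mem_closure_iff.1 hcl (W N ∩ U') ((hWo N).inter hU') ⟨hyW N, h2⟩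
      have : b ∈ f ⁻¹' U := by rw [← hOe]; exact hN (hWc N b h3.1)
      exact disjoint_left.1 hd this h3.2
  rw [key]
  exact isFsigmaDelta_iInter_sum hG hK

theorem weightLT_of_few {k : Cardinal.{u}} {S : Set (ℕ → T)} (hS : Few k S)
    {Z : Type u} [TopologicalSpace Z] {i : Z → ℕ → T} (hi : IsInducing i) (hiS : ∀ z, i z ∈ S) :
    WeightLT Z k := by
  obtain ⟨hk, κ, hκ, hpref⟩ := hS
  let b : (Σ n : ULift.{u} ℕ, pref S n.down) → Set Z := fun p =>
    i ⁻¹' {y | ∀ j : Fin p.1.down, y j = p.2.1 j}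
  refine ⟨range b, ?_, ?_⟩
  · refine TopologicalSpace.isTopologicalBasis_of_isOpen_of_nhds ?_ ?_
    · rintro _ ⟨⟨n, p, x, hx, rfl⟩, rfl⟩
      have : b ⟨n, ⟨_, x, hx, rfl⟩⟩ = i ⁻¹' (cyl x n.down) := by
        ext z
        exact ⟨fun h j hj => h ⟨j, hj⟩, fun h j => h j j.2⟩
      rw [this]
      exact (isOpen_cyl _ _).preimage hi.continuous
    · intro z U hz hU
      obtain ⟨O, hO, rfl⟩ := hi.isOpen_iff.1 hU
      obtain ⟨n, -, hn⟩ := exists_cyl_sub hO hz 0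
      refine ⟨b ⟨⟨n⟩, ⟨_, i z, hiS z, rfl⟩⟩, mem_range_self _, fun j => rfl, fun w hw => hn ?_⟩
      exact fun j hj => hw ⟨j, hj⟩
  · refine Cardinal.mk_range_le.trans_lt ?_
    rw [Cardinal.mk_sigma]
    refine (Cardinal.sum_le_mk_mul_iSup _).trans_lt ?_
    refine Cardinal.mul_lt_of_lt hk.le ?_ ?_
    · simpa using hk
    · exact (ciSup_le' fun n : ULift.{u} ℕ => hpref n.down).trans_lt hκ

theorem isFsigmaSet_compl {M : Type*} [TopologicalSpace M] {s : Set M} (h : IsGδ s) :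
    IsFsigmaSet sᶜ := by
  obtain ⟨f, hf, rfl⟩ := isGδ_iff_eq_iInter_nat.1 h
  exact ⟨fun n => (f n)ᶜ, fun n => (hf n).isClosed_compl, compl_iInter _⟩

theorem fsdMinusSLW_of_small {k : Cardinal.{u}} {Y : Set (ℕ → T)} (h : Small k Yᶜ) :
    FsdMinusSLW ↥Y k := by
  obtain ⟨P, Q, hP, hQ, hS⟩ := h
  let F : Set (ℕ → T) := (⋃ n, P n)ᶜ
  have hF : IsFsigmaDelta F := ⟨fun n => (P n)ᶜ, fun n => isFsigmaSet_compl (hP n), compl_iUnion _⟩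
  have hYF : Y ⊆ F := by
    intro y hy hyP
    have : y ∈ Yᶜ := by
      rw [hS]
      obtain ⟨n, hn⟩ := mem_iUnion.1 hyP
      exact mem_iUnion.2 ⟨n, Or.inl hn⟩
    exact this hy
  let L : Set ↥F := Subtype.val ⁻¹' Yᶜ
  refine ⟨TopCat.of ↥F, L, absFsigmaDelta hF, ?_, ?_⟩
  · refine ⟨fun n => {x | x.1.1 ∈ Q n}, ?_, fun n => ?_⟩
    · refine eq_univ_of_forall fun x => ?_
      have hx : x.1.1 ∈ Yᶜ := x.2
      rw [hS] at hx
      obtain ⟨n, hn⟩ := mem_iUnion.1 hx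
      rcases hn with hn | hn
      · exact (x.1.2 (mem_iUnion.2 ⟨n, hn⟩)).elim
      · exact mem_iUnion.2 ⟨n, hn⟩
    · intro x
      obtain ⟨m, hm⟩ := hQ n x.1.1.1 x.2
      have hc : IsInducing (fun z : {x : ↥L | x.1.1 ∈ Q n} => z.1.1.1) :=
        IsInducing.subtypeVal.comp (IsInducing.subtypeVal.comp IsInducing.subtypeVal)
      refine ⟨{z | z.1.1.1 ∈ cyl x.1.1.1 m}, ?_, ?_⟩
      · exact ((isOpen_cyl _ _).preimage hc.continuous).mem_nhds (self_mem_cyl _ _)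
      · exact weightLT_of_few hm (i := fun z => z.1.1.1.1) (hc.comp IsInducing.subtypeVal)
          fun z => ⟨z.1.2, z.2⟩
  · have hn : ∀ z : ↥(Lᶜ), z.1.1 ∈ Y := fun z => not_not.1 z.2
    exact ⟨{ toFun := fun y => ⟨⟨y.1, hYF y.2⟩, fun h => h y.2⟩
             invFun := fun z => ⟨z.1.1, hn z⟩
             left_inv := fun y => rfl
             right_inv := fun z => rfl
             continuous_toFun := by fun_prop
             continuous_invFun := by fun_prop }⟩

end Classes

section Models

/-- The sequences which are eventually equal to the basepoint. -/
abbrev Sig (T : Type u) (t0 : T) : Type u := {z : ℕ → T // ∀ᶠ i in atTop, z i = t0}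

theorem sig_congr {T : Type u} {T' : Type v} [TopologicalSpace T] [DiscreteTopology T]
    [TopologicalSpace T'] [DiscreteTopology T'] {t0 : T} {t0' : T'} (e : T ≃ T') :
    Nonempty (Sig T t0 ≃ₜ Sig T' t0') := by
  classical
  let e' := e.trans (Equiv.swap (e t0) t0')
  have he : e' t0 = t0' := Equiv.swap_apply_left _ _
  have he' : e'.symm t0' = t0 := by rw [← he, Equiv.symm_apply_apply]
  exact ⟨{ toFun := fun z => ⟨fun i => e' (z.1 i), z.2.mono fun i hi => (congrArg e' hi).trans he⟩
           invFun := fun z => ⟨fun i => e'.symm (z.1 i), z.2.mono fun i hi => (congrArg e'.symm hi).trans he'⟩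
           left_inv := fun z => Subtype.ext (funext fun i => e'.symm_apply_apply _)
           right_inv := fun z => Subtype.ext (funext fun i => e'.apply_symm_apply _)
           continuous_toFun := Continuous.subtype_mk (continuous_pi fun i =>
             continuous_of_discreteTopology.comp
               ((continuous_pi_iff.1 continuous_id i).comp continuous_subtype_val)) _
           continuous_invFun := Continuous.subtype_mk (continuous_pi fun i =>
             continuous_of_discreteTopology.comp
               ((continuous_pi_iff.1 continuous_id i).comp continuous_subtype_val)) _ }⟩

/-- The position of the `j`-th zero in the code of `z`. -/
def pos (z : ℕ → ℕ) : ℕ → ℕ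
  | 0 => z 0
  | j + 1 => pos z j + z (j + 1) + 1

theorem pos_strictMono (z : ℕ → ℕ) : StrictMono (pos z) :=
  strictMono_nat_of_lt_succ fun j => by simp only [pos]; omega

theorem pos_congr {z w : ℕ → ℕ} {n : ℕ} (h : ∀ i ≤ n, w i = z i) : pos w n = pos z n := by
  induction n with
  | zero => exact h 0 le_rfl
  | succ n ih => simp only [pos]; rw [ih fun i hi => h i (by omega), h _ le_rfl]

theorem of_pos_congr {z w : ℕ → ℕ} {n : ℕ} (h : ∀ i ≤ n, pos w i = pos z i) : w n = z n := by
  cases n with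
  | zero => exact h 0 le_rfl
  | succ n =>
    have h1 := h n (by omega)
    have h2 := h (n + 1) le_rfl
    simp only [pos] at h2
    omega

open Classical in
/-- Coding sequences of natural numbers by binary sequences. -/
noncomputable def code (z : ℕ → ℕ) : ℕ → Bool := fun i => !decide (∃ j, pos z j = i)

theorem code_eq_false {z : ℕ → ℕ} {i : ℕ} : code z i = false ↔ ∃ j, pos z j = i := by
  simp [code]

theorem code_congr {z w : ℕ → ℕ} {n : ℕ} (h : w ∈ cyl z (n + 1)) : code w n = code z n := by
  rw [Bool.eq_iff_iff, ← not_iff_not]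
  simp only [Bool.not_eq_true, code_eq_false]
  refine exists_congr fun j => ?_
  by_cases hj : j ≤ n
  · rw [pos_congr fun i hi => h i (by omega)]
  · have h1 := (pos_strictMono z).le_apply (x := j)
    have h2 := (pos_strictMono w).le_apply (x := j)
    omega

theorem pos_of_code {z w : ℕ → ℕ} {n : ℕ} (h : code w ∈ cyl (code z) (pos z n + 1)) :
    ∀ j ≤ n, pos w j = pos z j := by
  intro j
  induction j using Nat.strong_induction_on with
  | _ j ih =>
    intro hj
    have hle : pos z j ≤ pos z n := (pos_strictMono z).monotone hj
    have h1 : pos w j ≤ pos z j := by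
      obtain ⟨j', hj'⟩ := code_eq_false.1 ((h (pos z j) (by omega)).trans
        (code_eq_false.2 ⟨j, rfl⟩))
      rcases Nat.lt_or_ge j' j with hlt | hge
      · have := ih j' hlt (by omega)
        have := pos_strictMono z hlt
        omega
      · have := (pos_strictMono w).monotone hge
        omega
    obtain ⟨j', hj'⟩ := code_eq_false.1 ((h (pos w j) (by omega)).symm.trans
        (code_eq_false.2 ⟨j, rfl⟩))
    rcases Nat.lt_or_ge j' j with hlt | hge
    · have := ih j' hlt (by omega)
      have := pos_strictMono w hlt
      omega
    · have := (pos_strictMono z).monotone hge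
      omega

theorem continuous_code : Continuous code := by
  refine continuous_pi fun i => ?_
  exact (IsLocallyConstant.iff_exists_open _).2 (fun x => ⟨cyl x (i + 1), isOpen_cyl _ _,
    self_mem_cyl _ _, fun y hy => code_congr hy⟩) |>.continuous

theorem isInducing_code : IsInducing code := by
  refine isInducing_iff_nhds.2 fun x => le_antisymm (continuous_code.tendsto x).le_comap ?_
  intro s hs
  obtain ⟨V, hVs, hVo, hxV⟩ := mem_nhds_iff.1 hs
  obtain ⟨n, -, hn⟩ := exists_cyl_sub hVo hxV 0
  refine ⟨cyl (code x) (pos x n + 1), (isOpen_cyl _ _).mem_nhds (self_mem_cyl _ _),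
    fun z hz => hVs (hn fun i hi => ?_)⟩
  exact of_pos_congr fun j hj => pos_of_code hz j (by omega)

theorem code_injective : Function.Injective code := by
  intro z w h
  funext n
  refine of_pos_congr (n := n) fun j hj => pos_of_code (n := n) ?_ j hj
  rw [h]; exact self_mem_cyl _ _

theorem code_eventually {z : ℕ → ℕ} :
    (∀ᶠ i in atTop, code z i = false) ↔ ∀ᶠ i in atTop, z i = 0 := by
  simp only [eventually_atTop]
  constructor
  · rintro ⟨N, hN⟩
    refine ⟨N + 1, fun j hj => ?_⟩
    obtain ⟨j, rfl⟩ : ∃ j', j = j' + 1 := ⟨j - 1, by omega⟩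
    have h1 := (pos_strictMono z).le_apply (x := j)
    obtain ⟨j', hj'⟩ := code_eq_false.1 (hN (pos z j + 1) (by omega))
    have h2 : j < j' := (pos_strictMono z).lt_iff_lt.1 (by omega)
    have h3 : pos z (j + 1) ≤ pos z j' := (pos_strictMono z).monotone h2
    simp only [pos] at h3
    omega
  · rintro ⟨N, hN⟩
    refine ⟨pos z N, fun i hi => code_eq_false.2 ?_⟩
    induction i, hi using Nat.le_induction with
    | base => exact ⟨N, rfl⟩
    | succ i hi ih =>
      obtain ⟨j, hj⟩ := ih
      refine ⟨j + 1, ?_⟩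
      have : N ≤ j := (pos_strictMono z).le_iff_le.1 (by omega)
      simp only [pos]
      rw [hN (j + 1) (by omega), hj]

theorem code_surj {y : ℕ → Bool} (hy : ∀ᶠ i in atTop, y i = false) : ∃ z, code z = y := by
  have hinf : {i | y i = false}.Infinite := by
    obtain ⟨N, hN⟩ := eventually_atTop.1 hy
    exact infinite_of_forall_exists_gt fun a => ⟨max N (a + 1), hN _ (le_max_left _ _), by omega⟩
  let f := Nat.nth fun i => y i = false
  have hf : StrictMono f := Nat.nth_strictMono hinf
  have hr : range f = {i | y i = false} := Nat.range_nth_of_infinite hinf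
  let z : ℕ → ℕ := fun j => Nat.casesOn j (f 0) fun j => f (j + 1) - f j - 1
  have hp : ∀ j, pos z j = f j := by
    intro j
    induction j with
    | zero => rfl
    | succ j ih =>
      have h1 : f j < f (j + 1) := hf j.lt_succ_self
      have h2 : z (j + 1) = f (j + 1) - f j - 1 := rfl
      simp only [pos]
      omega
  refine ⟨z, funext fun i => ?_⟩
  rw [Bool.eq_iff_iff, ← not_iff_not]
  simp only [Bool.not_eq_true, code_eq_false, hp]
  change i ∈ range f ↔ i ∈ {i | y i = false}
  rw [hr]

theorem sig_nat_bool : Nonempty (Sig ℕ 0 ≃ₜ Sig Bool false) := by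
  let e : Sig ℕ 0 → Sig Bool false := fun z => ⟨code z.1, code_eventually.2 z.2⟩
  have hc : Continuous e := (continuous_code.comp continuous_subtype_val).subtype_mk _
  have hi : IsInducing e := IsInducing.of_comp hc continuous_subtype_val
    (isInducing_code.comp IsInducing.subtypeVal)
  have hb : Function.Bijective e := by
    constructor
    · intro z w h
      exact Subtype.ext (code_injective (congrArg Subtype.val h))
    · intro y
      obtain ⟨z, hz⟩ := code_surj y.2
      exact ⟨⟨z, code_eventually.1 (by rw [hz]; exact y.2)⟩, Subtype.ext hz⟩
  exact ⟨(Equiv.ofBijective e hb).toHomeomorphOfIsInducing hi⟩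

theorem mk_discT (k : Cardinal.{u}) : Cardinal.mk (DiscT k) = k := Cardinal.mk_out k

theorem mk_qBase {k : Cardinal.{u}} (hk : Cardinal.aleph0 ≤ k) : Cardinal.mk (QBase k) = k := by
  have : Cardinal.mk (QBase k) = Cardinal.mk (DiscT k ⊕ PUnit.{u + 1}) := rfl
  rw [this]
  simp [mk_discT, Cardinal.add_one_eq hk]

theorem starT_of_eq {k : Cardinal.{u}} (h : k = Cardinal.aleph0) : StarT k = ULift.{u} Bool :=
  if_pos h

theorem mk_starT {k : Cardinal.{u}} (h : k ≠ Cardinal.aleph0) : Cardinal.mk (StarT k) = k := by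
  have : StarT k = DiscT k := if_neg h
  rw [this, mk_discT]

theorem sig_qk {k : Cardinal.{u}} (hk : Cardinal.aleph0 ≤ k) (t0 : StarT k) :
    Nonempty (Sig (StarT k) t0 ≃ₜ Qk k) := by
  by_cases h : k = Cardinal.aleph0
  · have e1 : StarT k ≃ Bool := (Equiv.cast (starT_of_eq h)).trans Equiv.ulift
    have h2 : Cardinal.mk (QBase k) = Cardinal.aleph0 := (mk_qBase hk).trans h
    obtain ⟨d⟩ := Cardinal.denumerable_iff.2 h2
    have e2 : QBase k ≃ ℕ := Denumerable.eqv _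
    obtain ⟨f1⟩ := sig_congr (t0 := t0) (t0' := false) e1
    obtain ⟨f2⟩ := sig_congr (T := QBase k) (t0 := Sum.inr PUnit.unit) (t0' := 0) e2
    obtain ⟨f3⟩ := sig_nat_bool
    exact ⟨f1.trans (f3.symm.trans f2.symm)⟩
  · obtain ⟨e⟩ := Cardinal.eq.1 ((mk_starT h).trans (mk_qBase hk).symm)
    exact sig_congr e

/-- The model of `Q(k)^ω` in the product. -/
def modA (T : Type u) (t0 : T) : Set (ℕ → T) := {x | ∀ m, ∀ᶠ n in atTop, row n = m → x n = t0}

theorem dense_modA {T : Type u} [TopologicalSpace T] [DiscreteTopology T] (t0 : T) :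
    Dense (modA T t0) := by
  intro x
  rw [mem_closure_iff]
  intro U hU hx
  obtain ⟨n, -, hn⟩ := exists_cyl_sub hU hx 0
  refine ⟨fun i => if i < n then x i else t0, hn fun i hi => if_pos hi, fun m => ?_⟩
  filter_upwards [eventually_ge_atTop n] with i hi _
  exact if_neg (by omega)

theorem modA_homeo {T : Type u} [TopologicalSpace T] [DiscreteTopology T] (t0 : T) :
    Nonempty (↥(modA T t0) ≃ₜ (ℕ → Sig T t0)) := by
  have h1 : ∀ (x : ↥(modA T t0)) (m : ℕ), ∀ᶠ i in atTop, x.1 (Nat.pair m i) = t0 := by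
    intro x m
    obtain ⟨N, hN⟩ := eventually_atTop.1 (x.2 m)
    filter_upwards [eventually_ge_atTop N] with i hi
    exact hN _ (hi.trans (Nat.right_le_pair _ _)) (by simp [row])
  have h2 : ∀ z : ℕ → Sig T t0, (fun n : ℕ => (z n.unpair.1).1 n.unpair.2) ∈ modA T t0 := by
    intro z m
    obtain ⟨N, hN⟩ := eventually_atTop.1 (z m).2
    filter_upwards [eventually_ge_atTop (Nat.pair m N)] with n hn hr
    have hr' : n.unpair.1 = m := hr
    change (z n.unpair.1).1 n.unpair.2 = t0
    rw [hr']
    refine hN _ ?_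
    by_contra hlt
    have := Nat.pair_lt_pair_right m (not_le.1 hlt)
    rw [← hr', Nat.pair_unpair, hr'] at this
    omega
  refine ⟨{ toFun := fun x m => ⟨fun i => x.1 (Nat.pair m i), h1 x m⟩
            invFun := fun z => ⟨_, h2 z⟩
            left_inv := fun x => Subtype.ext (funext fun n => by simp)
            right_inv := fun z => funext fun m => Subtype.ext (funext fun i => by simp)
            continuous_toFun := ?_
            continuous_invFun := ?_ }⟩
  · refine continuous_pi fun m => Continuous.subtype_mk (continuous_pi fun i => ?_) _
    exact (continuous_pi_iff.1 continuous_id _).comp continuous_subtype_val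
  · refine Continuous.subtype_mk (continuous_pi fun n => ?_) _
    exact (continuous_pi_iff.1 continuous_id _).comp
      (continuous_subtype_val.comp (continuous_pi_iff.1 continuous_id _))

end Models

section Final

theorem final {T : Type u} [TopologicalSpace T] [DiscreteTopology T] {k : Cardinal.{u}}
    (t0 : T) (hT : (∃ t1, ∀ t, t ≠ t0 → t = t1) ∨ (Cardinal.aleph0 < k ∧ Cardinal.mk T = k))
    {Y : Set (ℕ → T)} (hY : IsGdeltaSigma Y) (hS : ¬ Small k Yᶜ) :
    ∃ C : Set ↥Y, IsClosed C ∧ IsNowhereDense C ∧ Nonempty (↥C ≃ₜ ↥((modA T t0)ᶜ)) := by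
  obtain ⟨G, hG, hYG⟩ := hY
  have hX : Yᶜ = (⋃ j, G j)ᶜ := by rw [hYG]
  obtain ⟨E, hE, ⟨e, he⟩, -⟩ := lemmaA (C := univ) hG hX isClosed_univ (by rwa [inter_univ])
  obtain ⟨E', hE', hne', hsub, -, -, i, hi⟩ := lemmaB hG hX hE he 0 0
  obtain ⟨h, hce, hr, hh⟩ := main_embedding hG hX t0 hT hE' hne'
  have hcl : IsClosed (Subtype.val ⁻¹' (range h) : Set ↥Y) :=
    hce.isClosed_range.preimage continuous_subtype_val
  refine ⟨Subtype.val ⁻¹' (range h), hcl, ?_, ?_⟩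
  · rw [hcl.isNowhereDense_iff, eq_empty_iff_forall_notMem]
    intro y hy
    obtain ⟨V, hVs, hVo, hyV⟩ := mem_interior.1 hy
    obtain ⟨O, hO, rfl⟩ := isOpen_induced_iff.1 hVo
    obtain ⟨n, -, hn⟩ := exists_cyl_sub hO hyV 0
    have hyE1 : y.1 ∈ E.1 := hsub (hr (hVs hyV))
    obtain ⟨z, hz, hzc, hzD⟩ := hE.nwd i y.1 hyE1 n
    obtain ⟨n', hn', hs⟩ := exists_cyl_sub (hE.closedD i).isOpen_compl hzD n
    apply hE.big z hz n'
    have : Yᶜ ∩ E.1 ∩ cyl z n' = E.1 ∩ cyl z n' := by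
      ext w
      refine ⟨fun hw => ⟨hw.1.2, hw.2⟩, fun hw => ⟨⟨fun hwY => ?_, hw.1⟩, hw.2⟩⟩
      have hwO : w ∈ O := hn (cyl_sub hn' hzc hw.2)
      have : w ∈ range h := hVs (a := ⟨w, hwY⟩) hwO
      exact hs hw.2 (hi (hr this))
    rw [this]
    exact small_of_isGδ (closed_isGδ (hE.closed.inter (isClosed_cyl _ _)))
  · have hmem : ∀ x : ↥((modA T t0)ᶜ), h x.1 ∈ Y := fun x => by
      by_contra hx
      exact x.2 ((hh x.1).1 hx)
    let f : ↥((modA T t0)ᶜ) → ↥(Subtype.val ⁻¹' (range h) : Set ↥Y) := fun x =>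
      ⟨⟨h x.1, hmem x⟩, x.1, rfl⟩
    have hc : Continuous f :=
      ((hce.continuous.comp continuous_subtype_val).subtype_mk _).subtype_mk _
    have hind : IsInducing f := IsInducing.of_comp hc
      (continuous_subtype_val.comp continuous_subtype_val)
      (hce.isInducing.comp IsInducing.subtypeVal)
    have hb : Function.Bijective f := by
      constructor
      · intro x y hxy
        exact Subtype.ext (hce.injective (congrArg (fun z => z.1.1) hxy))
      · intro y
        obtain ⟨x, hx⟩ := y.2
        have hxY : h x ∈ Y := by rw [hx]; exact y.1.2
        exact ⟨⟨x, fun hx' => (hh x).2 hx' hxY⟩, Subtype.ext (Subtype.ext hx)⟩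
    exact ⟨((Equiv.ofBijective f hb).toHomeomorphOfIsInducing hind).symm⟩

theorem main (k : Cardinal.{u}) (hk : Cardinal.aleph0 ≤ k)
    (Y : Set (BaireStar k)) (hY : IsGdeltaSigma Y)
    (hnot : ¬ FsdMinusSLW ↥Y k) :
    ∃ C : Set ↥Y, IsClosed C ∧ IsNowhereDense C ∧ IsAII k ↥C := by
  have hT : ∃ t0 : StarT k, (∃ t1, ∀ t, t ≠ t0 → t = t1) ∨
      (Cardinal.aleph0 < k ∧ Cardinal.mk (StarT k) = k) := by
    by_cases h : k = Cardinal.aleph0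
    · have e : StarT k ≃ Bool := (Equiv.cast (starT_of_eq h)).trans Equiv.ulift
      refine ⟨e.symm false, Or.inl ⟨e.symm true, fun t ht => ?_⟩⟩
      rw [Equiv.eq_symm_apply]
      by_contra hf
      exact ht (by rw [Equiv.eq_symm_apply]; simpa using hf)
    · have h0 : Cardinal.mk (StarT k) ≠ 0 := by
        rw [mk_starT h]
        exact (Cardinal.aleph0_pos.trans_le hk).ne'
      obtain ⟨t0⟩ := Cardinal.mk_ne_zero_iff.1 h0
      exact ⟨t0, Or.inr ⟨lt_of_le_of_ne hk (Ne.symm h), mk_starT h⟩⟩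
  obtain ⟨t0, hT⟩ := hT
  obtain ⟨C, h1, h2, h3⟩ := final (T := StarT k) (Y := Y) t0 hT hY
    fun hS => hnot (fsdMinusSLW_of_small (T := StarT k) (Y := Y) hS)
  refine ⟨C, h1, h2, modA (StarT k) t0, dense_modA t0, ?_, h3⟩
  obtain ⟨f1⟩ := modA_homeo t0
  obtain ⟨f2⟩ := sig_qk hk t0
  exact ⟨f1.trans (Homeomorph.piCongrRight fun _ => f2)⟩

end Final

end AIIProof

/-- Corollary `c-ca2`: a `G_δσ`-subset of `B*(k)` which is not in the
class `𝓕_σδ ∖ σLW(<k)` contains a nowhere dense closed copy of `A^{II}_k`. -/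
theorem stmt_16 (k : Cardinal.{u}) (hk : Cardinal.aleph0 ≤ k)
    (Y : Set (BaireStar k)) (hY : IsGdeltaSigma Y)
    (hnot : ¬ FsdMinusSLW ↥Y k) :
    ∃ C : Set ↥Y, IsClosed C ∧ IsNowhereDense C ∧ IsAII k ↥C := by
  exact AIIProof.main k hk Y hY hnot
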